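/- arXiv:2507.01672 — 2 statements merged into one kernel-verified Lean document; each statement's English description precedes it below -/
import Mathlib

section
/- Let P = conv(v_1,…,v_n), n ≥ 4, be a convex polygon as in the context, with adjoint polynomial α_P, and assume the projective adjoint curve is smooth: there is no nonzero (z_0, z_1, z_2) ∈ ℂ³ at which all three partial derivatives of the homogenization α_P^h(x_0, x_1, x_2) = x_0^{n−3} α_P(x_1/x_0, x_2/x_0) vanish. Then there exist an (n−3)×(n−3) symmetric matrix M whose entries are real polynomials of degree at most 1 in (x_1, x_2) and nonzero real numbers c_1, …, c_{n−3} such that: (i) M is tridiagonal, i.e., its (i,j) entry is zero whenever |i − j| ≥ 2; and (ii) for every 1 ≤ k ≤ n−3 the determinant of the leading k×k submatrix of M equals c_k · α_{P_k}, where P_k = conv(v_1, …, v_{k+3}); in particular det M = c_{n−3} · α_P. -/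
open MvPolynomial

/-- The affine-linear form `l(x) = c + w₀ x₁ + w₁ x₂` with inward normal `w`. -/
noncomputable def linForm (w : Fin 2 → ℝ) (c : ℝ) : MvPolynomial (Fin 2) ℝ :=
  C c + C (w 0) * X 0 + C (w 1) * X 1

/-- Determinant of the 2×2 matrix with columns `a`, `b`. -/
def det2 (a b : Fin 2 → ℝ) : ℝ := a 0 * b 1 - a 1 * b 0

/-- Warren's adjoint polynomial of an `m`-gon with facet data `(w, c)` (indices `0,…,m-1`
read cyclically): `α(x) = Σᵢ det(wᵢ, wᵢ₊₁) Π_{j ∉ {i,i+1}} lⱼ(x)`. -/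
noncomputable def adjPoly (m : ℕ) (w : ℕ → Fin 2 → ℝ) (c : ℕ → ℝ) :
    MvPolynomial (Fin 2) ℝ :=
  ∑ i ∈ Finset.range m, C (det2 (w i) (w ((i + 1) % m))) *
    ∏ j ∈ ((Finset.range m).erase i).erase ((i + 1) % m), linForm (w j) (c j)

/-- `v 0, …, v (m-1)` are the vertices, in counterclockwise order, of a convex `m`-gon in
which every `v i` is a vertex, and for each `i` the affine-linear form
`lᵢ = linForm (w i) (c i)` vanishes on the edge from `v (i-1)` to `v i` and is strictly
positive at all the other vertices (hence on the interior of the polygon); counterclockwise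
orientation is recorded by `det(wᵢ, wᵢ₊₁) > 0`. -/
structure IsPolygonData (m : ℕ) (v w : ℕ → Fin 2 → ℝ) (c : ℕ → ℝ) : Prop where
  three_le : 3 ≤ m
  vanish_prev : ∀ i < m, eval (v ((i + m - 1) % m)) (linForm (w i) (c i)) = 0
  vanish_self : ∀ i < m, eval (v i) (linForm (w i) (c i)) = 0
  pos_other : ∀ i < m, ∀ j < m, j ≠ (i + m - 1) % m → j ≠ i →
    0 < eval (v j) (linForm (w i) (c i))
  ccw : ∀ i < m, 0 < det2 (w i) (w ((i + 1) % m))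

/-- `p` is (a representative of) the adjoint polynomial of the convex `m`-gon with
vertices `v 0, …, v (m-1)`, for some admissible choice of facet forms. -/
def IsAdjointOf (m : ℕ) (v : ℕ → Fin 2 → ℝ) (p : MvPolynomial (Fin 2) ℝ) : Prop :=
  ∃ w c, IsPolygonData m v w c ∧ p = adjPoly m w c

/-- The degree-`d` homogenization `p^h(x₀,x₁,x₂) = x₀^d · p(x₁/x₀, x₂/x₀)` of a
polynomial `p(x₁,x₂)` of total degree at most `d`. -/
noncomputable def homogenize (d : ℕ) (p : MvPolynomial (Fin 2) ℝ) :
    MvPolynomial (Fin 3) ℝ :=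
  ∑ m ∈ p.support, C (coeff m p) *
    (X 0 ^ (d - (m 0 + m 1)) * X 1 ^ (m 0) * X 2 ^ (m 1))


/-- The determinant of a matrix whose last row and last column vanish away from their final two
entries. -/
theorem Matrix.det_of_last_row_col_eq_zero {R : Type*} [CommRing R] {n : ℕ}
    (M : Matrix (Fin (n + 2)) (Fin (n + 2)) R)
    (hrow : ∀ j : Fin n, M (Fin.last (n + 1)) j.castSucc.castSucc = 0)
    (hcol : ∀ i : Fin n, M i.castSucc.castSucc (Fin.last (n + 1)) = 0) :
    M.det = M (Fin.last _) (Fin.last _) * (M.submatrix Fin.castSucc Fin.castSucc).det -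
      M (Fin.last _) (Fin.last n).castSucc * M (Fin.last n).castSucc (Fin.last _) *
        (M.submatrix (fun i : Fin n => i.castSucc.castSucc)
          (fun i : Fin n => i.castSucc.castSucc)).det := by
  have hminor : (M.submatrix (Fin.last (n + 1)).succAbove
      (Fin.last n).castSucc.succAbove).det =
      M (Fin.last n).castSucc (Fin.last _) *
        (M.submatrix (fun i : Fin n => i.castSucc.castSucc)
          (fun i : Fin n => i.castSucc.castSucc)).det := by
    rw [Matrix.det_succ_column _ (Fin.last n), Fin.sum_univ_castSucc]
    have hlast : (Fin.last n).castSucc.succAbove (Fin.last n) = Fin.last (n + 1) := by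
      rw [Fin.succAbove_castSucc_self, Fin.succ_last]
    have hinit (i : Fin n) : (Fin.last n).castSucc.succAbove i.castSucc = i.castSucc.castSucc :=
      Fin.succAbove_of_castSucc_lt _ _ (Fin.castSucc_lt_castSucc_iff.2 (Fin.castSucc_lt_last i))
    have hsub : (M.submatrix (Fin.last (n + 1)).succAbove
        (Fin.last n).castSucc.succAbove).submatrix (Fin.last n).succAbove (Fin.last n).succAbove =
        M.submatrix (fun i : Fin n => i.castSucc.castSucc)
          (fun i : Fin n => i.castSucc.castSucc) := by
      ext i j
      simp [hinit]
    rw [hsub]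
    simp [hlast, hcol, ← two_mul]
  rw [Matrix.det_succ_row _ (Fin.last (n + 1)), Fin.sum_univ_castSucc, Fin.sum_univ_castSucc,
    hminor]
  have hsub : M.submatrix (Fin.last (n + 1)).succAbove (Fin.last (n + 1)).succAbove =
      M.submatrix Fin.castSucc Fin.castSucc := by
    ext i j
    simp
  have hsign : (-1 : R) ^ (n + 1 + n) = -1 := Odd.neg_one_pow ⟨n, by ring⟩
  have hsign' : (-1 : R) ^ (n + 1 + (n + 1)) = 1 := Even.neg_one_pow ⟨n + 1, rfl⟩
  rw [hsub]
  simp only [hrow, Fin.val_last, Fin.val_castSucc, hsign, hsign', mul_zero, zero_mul,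
    Finset.sum_const_zero]
  ring

/-- The symmetric tridiagonal `N × N` matrix with diagonal `a 0, …, a (N - 1)` and off-diagonal
entries `b 1, …, b (N - 1)`. -/
def symmTridiagonal {R : Type*} [Zero R] (a b : ℕ → R) (N : ℕ) : Matrix (Fin N) (Fin N) R :=
  Matrix.of fun i j =>
    if i.val = j.val then a i else if i.val = j.val + 1 then b i
    else if j.val = i.val + 1 then b j else 0

theorem symmTridiagonal_isSymm {R : Type*} [Zero R] (a b : ℕ → R) (N : ℕ) :
    (symmTridiagonal a b N).IsSymm := by
  ext i j
  simp only [symmTridiagonal, Matrix.transpose_apply, Matrix.of_apply]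
  split_ifs <;> first | rfl | omega | simp_all

theorem symmTridiagonal_submatrix_castLE {R : Type*} [Zero R] (a b : ℕ → R) {m N : ℕ}
    (h : m ≤ N) :
    (symmTridiagonal a b N).submatrix (Fin.castLE h) (Fin.castLE h) = symmTridiagonal a b m :=
  rfl

theorem det_symmTridiagonal_add_two {R : Type*} [CommRing R] (a b : ℕ → R) (N : ℕ) :
    (symmTridiagonal a b (N + 2)).det = a (N + 1) * (symmTridiagonal a b (N + 1)).det -
      b (N + 1) ^ 2 * (symmTridiagonal a b N).det := by
  rw [Matrix.det_of_last_row_col_eq_zero]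
  · have h₁ : (symmTridiagonal a b (N + 2)).submatrix Fin.castSucc Fin.castSucc =
        symmTridiagonal a b (N + 1) := rfl
    have h₂ : (symmTridiagonal a b (N + 2)).submatrix (fun i : Fin N => i.castSucc.castSucc)
        (fun i : Fin N => i.castSucc.castSucc) = symmTridiagonal a b N := rfl
    rw [h₁, h₂]
    simp only [symmTridiagonal, Matrix.of_apply, Fin.val_last, Fin.val_castSucc, if_true]
    rw [if_neg (show ¬ N + 1 = N by omega), if_neg (show ¬ N = N + 1 by omega),
      if_neg (show ¬ N = N + 1 + 1 by omega)]
    ring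
  · intro j
    have := j.isLt
    simp only [symmTridiagonal, Matrix.of_apply, Fin.val_last, Fin.val_castSucc]
    rw [if_neg (by omega), if_neg (by omega), if_neg (by omega)]
  · intro j
    have := j.isLt
    simp only [symmTridiagonal, Matrix.of_apply, Fin.val_last, Fin.val_castSucc]
    rw [if_neg (by omega), if_neg (by omega), if_neg (by omega)]

/-- Twice the signed area of the triangle `p q r`. -/
def signedArea (p q r : Fin 2 → ℝ) : ℝ :=
  (q 0 - p 0) * (r 1 - p 1) - (q 1 - p 1) * (r 0 - p 0)

/-- The affine-linear form `x ↦ signedArea p q x` vanishing on the line through `p` and `q`. -/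
noncomputable def lineForm (p q : Fin 2 → ℝ) : MvPolynomial (Fin 2) ℝ :=
  C (q 0 - p 0) * (X 1 - C (p 1)) - C (q 1 - p 1) * (X 0 - C (p 0))

theorem eval_lineForm (p q x : Fin 2 → ℝ) : eval x (lineForm p q) = signedArea p q x := by
  simp [lineForm, signedArea]

theorem totalDegree_C_mul_lineForm_le (t : ℝ) (p q : Fin 2 → ℝ) :
    (C t * lineForm p q).totalDegree ≤ 1 := by
  have h (s r : ℝ) (i : Fin 2) : (C s * (X i - C r) : MvPolynomial (Fin 2) ℝ).totalDegree ≤ 1 := by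
    refine (totalDegree_mul _ _).trans ?_
    have := totalDegree_sub_C_le (X i : MvPolynomial (Fin 2) ℝ) r
    rw [totalDegree_X] at this
    simpa using this
  refine (totalDegree_mul _ _).trans ?_
  rw [totalDegree_C, zero_add]
  exact (totalDegree_sub _ _).trans (max_le (h _ _ _) (h _ _ _))

/-- The open-chain part of the adjoint of the polygon `v 0, …, v (k + 1)`: the contributions of the
interior vertices `v 1, …, v k` without the factor of the closing edge. -/
noncomputable def chainSum (v : ℕ → Fin 2 → ℝ) (k : ℕ) : MvPolynomial (Fin 2) ℝ :=
  ∑ i ∈ Finset.range k, C (signedArea (v i) (v (i + 1)) (v (i + 2))) *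
    ∏ j ∈ ((Finset.range (k + 1)).erase i).erase (i + 1), lineForm (v j) (v (j + 1))

/-- The adjoint of the polygon `v 0, …, v (k + 1)` with facet forms `lineForm`. -/
noncomputable def vertexAdj (v : ℕ → Fin 2 → ℝ) (k : ℕ) : MvPolynomial (Fin 2) ℝ :=
  lineForm (v (k + 1)) (v 0) * chainSum v k +
    C (signedArea (v (k + 1)) (v 0) (v 1)) *
      ∏ j ∈ Finset.range k, lineForm (v (j + 1)) (v (j + 2)) +
    C (signedArea (v k) (v (k + 1)) (v 0)) *
      ∏ j ∈ Finset.range k, lineForm (v j) (v (j + 1))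

theorem chainSum_succ (v : ℕ → Fin 2 → ℝ) (k : ℕ) :
    chainSum v (k + 1) = chainSum v k * lineForm (v (k + 1)) (v (k + 2)) +
      C (signedArea (v k) (v (k + 1)) (v (k + 2))) *
        ∏ j ∈ Finset.range k, lineForm (v j) (v (j + 1)) := by
  rw [chainSum, Finset.sum_range_succ, chainSum, Finset.sum_mul]
  congr 1
  · refine Finset.sum_congr rfl fun i hi => ?_
    have hi := Finset.mem_range.1 hi
    have : ((Finset.range (k + 1 + 1)).erase i).erase (i + 1) =
        insert (k + 1) (((Finset.range (k + 1)).erase i).erase (i + 1)) := by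
      ext j
      simp only [Finset.mem_erase, Finset.mem_range, Finset.mem_insert]
      omega
    rw [this, Finset.prod_insert (by simp)]
    ring
  · congr 2
    ext j
    simp only [Finset.mem_erase, Finset.mem_range]
    omega

theorem vertexAdj_zero (v : ℕ → Fin 2 → ℝ) : vertexAdj v 0 = 0 := by
  simp [vertexAdj, chainSum, signedArea]

theorem vertexAdj_one (v : ℕ → Fin 2 → ℝ) :
    vertexAdj v 1 = C (signedArea (v 0) (v 1) (v 2) ^ 2) := by
  simp [vertexAdj, chainSum_succ, signedArea, lineForm]
  simp [chainSum]
  ring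

/-- Cutting off the triangle at the last vertex. -/
theorem vertexAdj_succ_mul (v : ℕ → Fin 2 → ℝ) (k : ℕ) :
    vertexAdj v (k + 1) * lineForm (v (k + 1)) (v 0) =
      vertexAdj v k * lineForm (v (k + 1)) (v (k + 2)) * lineForm (v (k + 2)) (v 0) -
        C (signedArea (v (k + 1)) (v (k + 2)) (v 0)) ^ 2 *
          ∏ j ∈ Finset.range (k + 1), lineForm (v j) (v (j + 1)) := by
  have key : (∏ j ∈ Finset.range k, lineForm (v (j + 1)) (v (j + 2))) * lineForm (v 0) (v 1) =
      (∏ j ∈ Finset.range k, lineForm (v j) (v (j + 1))) * lineForm (v k) (v (k + 1)) := by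
    rw [← Finset.prod_range_succ (fun j => lineForm (v j) (v (j + 1))), Finset.prod_range_succ']
  rw [vertexAdj, vertexAdj, chainSum_succ, Finset.prod_range_succ, Finset.prod_range_succ]
  generalize (∏ j ∈ Finset.range k, lineForm (v (j + 1)) (v (j + 2))) = U at key ⊢
  generalize (∏ j ∈ Finset.range k, lineForm (v j) (v (j + 1))) = V at key ⊢
  generalize chainSum v k = S
  generalize v (k + 2) = c at key ⊢
  generalize v (k + 1) = b at key ⊢
  generalize v k = a at key ⊢
  generalize v 0 = p at key ⊢
  generalize v 1 = q at key ⊢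
  have hp : lineForm b p * C (signedArea c p q) - lineForm c p * C (signedArea b p q) =
      - C (signedArea b c p) * lineForm p q := by
    simp only [lineForm, signedArea, C_sub, C_mul]
    ring
  have hb : lineForm b p * C (signedArea a b c) - lineForm b c * C (signedArea a b p) =
      - C (signedArea b c p) * lineForm a b := by
    simp only [lineForm, signedArea, C_sub, C_mul]
    ring
  have hs : lineForm b c + lineForm c p - lineForm b p = C (signedArea b c p) := by
    simp only [lineForm, signedArea, C_sub, C_mul]
    ring
  linear_combination (-C (signedArea b c p) * lineForm b c) * key + U * lineForm b c * hp +
    V * lineForm c p * hb - C (signedArea b c p) * V * lineForm a b * hs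

theorem lineForm_quadric_identity (a b c p : Fin 2 → ℝ) :
    C (signedArea a b p ^ 2) * (lineForm b c * lineForm c p) +
        C (signedArea b c p ^ 2) * (lineForm a b * lineForm a p) =
      lineForm b p * -(C (signedArea a b c * signedArea b c p) * lineForm a p +
        C (signedArea a b c * signedArea a p c) * lineForm b p +
        C (signedArea a p c * signedArea b c p) * lineForm a b) := by
  have hb : C (signedArea a b p) * lineForm b c =
      C (signedArea a b c) * lineForm b p + C (signedArea b c p) * lineForm a b := by
    simp only [lineForm, signedArea, C_sub, C_mul]
    ring
  have hp : C (signedArea a b p) * lineForm c p =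
      -C (signedArea b c p) * lineForm a p - C (signedArea a p c) * lineForm b p := by
    simp only [lineForm, signedArea, C_sub, C_mul]
    ring
  simp only [C_mul, C_pow]
  linear_combination C (signedArea a b p) * lineForm c p * hb +
    (C (signedArea a b c) * lineForm b p + C (signedArea b c p) * lineForm a b) * hp

/-- The linear coefficient in the three-term recursion for adjoints, when the vertex `c` is added
after the vertices `p, …, a, b`. -/
noncomputable def recDiag (a b c p : Fin 2 → ℝ) : MvPolynomial (Fin 2) ℝ :=
  C ((signedArea a b p ^ 2)⁻¹) *
    -(C (signedArea a b c * signedArea b c p) * lineForm a p +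
      C (signedArea a b c * signedArea a p c) * lineForm b p +
      C (signedArea a p c * signedArea b c p) * lineForm a b)

/-- The linear form whose square appears in the three-term recursion for adjoints. -/
noncomputable def recOffDiag (a b c p : Fin 2 → ℝ) : MvPolynomial (Fin 2) ℝ :=
  C (signedArea b c p / signedArea a b p) * lineForm a b

theorem C_mul_recDiag {a b p : Fin 2 → ℝ} (c : Fin 2 → ℝ) (h : signedArea a b p ≠ 0) :
    C (signedArea a b p ^ 2) * recDiag a b c p =
      -(C (signedArea a b c * signedArea b c p) * lineForm a p +
        C (signedArea a b c * signedArea a p c) * lineForm b p +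
        C (signedArea a p c * signedArea b c p) * lineForm a b) := by
  rw [recDiag, ← mul_assoc, ← C_mul, mul_inv_cancel₀ (pow_ne_zero 2 h), C_1, one_mul]

theorem C_mul_recOffDiag {a b p : Fin 2 → ℝ} (c : Fin 2 → ℝ) (h : signedArea a b p ≠ 0) :
    C (signedArea a b p) * recOffDiag a b c p = C (signedArea b c p) * lineForm a b := by
  rw [recOffDiag, ← mul_assoc, ← C_mul, mul_div_cancel₀ _ h]

theorem totalDegree_recDiag_le (a b c p : Fin 2 → ℝ) : (recDiag a b c p).totalDegree ≤ 1 := by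
  rw [recDiag]
  refine (totalDegree_mul _ _).trans ?_
  rw [totalDegree_C, zero_add, totalDegree_neg]
  have h := totalDegree_C_mul_lineForm_le
  exact (totalDegree_add _ _).trans
    (max_le ((totalDegree_add _ _).trans (max_le (h _ _ _) (h _ _ _))) (h _ _ _))

theorem totalDegree_recOffDiag_le (a b c p : Fin 2 → ℝ) :
    (recOffDiag a b c p).totalDegree ≤ 1 :=
  totalDegree_C_mul_lineForm_le _ _ _

/-- The three-term recursion for adjoints of polygons `v 0, …, v m`. -/
theorem vertexAdj_add_two (v : ℕ → Fin 2 → ℝ) (k : ℕ)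
    (h : signedArea (v (k + 1)) (v (k + 2)) (v 0) ≠ 0) :
    vertexAdj v (k + 2) =
      recDiag (v (k + 1)) (v (k + 2)) (v (k + 3)) (v 0) * vertexAdj v (k + 1) -
        recOffDiag (v (k + 1)) (v (k + 2)) (v (k + 3)) (v 0) ^ 2 * vertexAdj v k := by
  have h₁ := vertexAdj_succ_mul v (k + 1)
  have h₀ := vertexAdj_succ_mul v k
  have hq := lineForm_quadric_identity (v (k + 1)) (v (k + 2)) (v (k + 3)) (v 0)
  have hm : lineForm (v (k + 2)) (v 0) ≠ 0 := by
    intro h0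
    have := eval_lineForm (v (k + 2)) (v 0) (v (k + 1))
    rw [h0, map_zero] at this
    apply h
    simp only [signedArea] at this ⊢
    linarith
  rw [Finset.prod_range_succ] at h₁
  simp only [add_assoc, Nat.reduceAdd] at h₁ h₀
  have hdiag := C_mul_recDiag (v (k + 3)) h
  have hoff := congrArg (· ^ 2) (C_mul_recOffDiag (v (k + 3)) h)
  simp only [mul_pow, C_pow] at hdiag hoff hq
  refine mul_right_cancel₀ hm (mul_left_cancel₀ (pow_ne_zero 2 (C_ne_zero.2 h)) ?_)
  linear_combination
    C (signedArea (v (k + 1)) (v (k + 2)) (v 0)) ^ 2 * h₁ + vertexAdj v (k + 1) * hq -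
    C (signedArea (v (k + 2)) (v (k + 3)) (v 0)) ^ 2 * lineForm (v (k + 1)) (v (k + 2)) * h₀ -
    vertexAdj v (k + 1) * lineForm (v (k + 2)) (v 0) * hdiag +
    vertexAdj v k * lineForm (v (k + 2)) (v 0) * hoff

theorem vertexAdj_eq_det (v : ℕ → Fin 2 → ℝ) (k : ℕ)
    (h : ∀ i < k + 1, signedArea (v (i + 1)) (v (i + 2)) (v 0) ≠ 0) :
    vertexAdj v (k + 1) = C (signedArea (v 0) (v 1) (v 2) ^ 2) *
      (symmTridiagonal (fun i => recDiag (v (i + 1)) (v (i + 2)) (v (i + 3)) (v 0))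
        (fun i => recOffDiag (v (i + 1)) (v (i + 2)) (v (i + 3)) (v 0)) k).det := by
  induction k using Nat.twoStepInduction with
  | zero => simp [vertexAdj_one]
  | one =>
    rw [vertexAdj_add_two v 0 (h 0 (by omega)), vertexAdj_zero, vertexAdj_one]
    simp [symmTridiagonal]
    ring
  | more k ih₀ ih₁ =>
    rw [vertexAdj_add_two v (k + 1) (h (k + 1) (by omega)), det_symmTridiagonal_add_two,
      ih₀ fun i hi => h i (by omega), ih₁ fun i hi => h i (by omega)]
    ring

theorem exists_linForm_eq (w : Fin 2 → ℝ) (c : ℝ) (p q : Fin 2 → ℝ) (hpq : p ≠ q)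
    (hp : eval p (linForm w c) = 0) (hq : eval q (linForm w c) = 0) :
    ∃ s : ℝ, w 0 = s * -(q 1 - p 1) ∧ w 1 = s * (q 0 - p 0) ∧
      linForm w c = C s * lineForm p q := by
  simp only [linForm, map_add, map_mul, eval_C, eval_X] at hp hq
  have hperp : w 0 * (q 0 - p 0) + w 1 * (q 1 - p 1) = 0 := by linarith
  have hs : ∃ s : ℝ, w 0 = s * -(q 1 - p 1) ∧ w 1 = s * (q 0 - p 0) := by
    by_cases h0 : q 0 - p 0 = 0
    · have h1 : q 1 - p 1 ≠ 0 := by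
        intro h1
        apply hpq
        ext i
        fin_cases i
        · simpa using (sub_eq_zero.1 h0).symm
        · simpa using (sub_eq_zero.1 h1).symm
      refine ⟨-w 0 / (q 1 - p 1), by field_simp, ?_⟩
      rw [h0, mul_zero, zero_add] at hperp
      rw [h0, mul_zero]
      exact (mul_eq_zero.1 hperp).resolve_right h1
    · refine ⟨w 1 / (q 0 - p 0), ?_, by field_simp⟩
      field_simp
      linarith
  obtain ⟨s, h0, h1⟩ := hs
  refine ⟨s, h0, h1, ?_⟩
  have hc : c = -(w 0 * p 0 + w 1 * p 1) := by linarith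
  rw [linForm, lineForm, hc, h0, h1]
  simp only [map_neg, map_add, map_mul, map_sub]
  ring

/-- The adjoint with facet forms `lineForm`, as a cyclic sum. -/
theorem vertexAdj_eq_sum (v : ℕ → Fin 2 → ℝ) (k : ℕ) :
    vertexAdj v (k + 1) = ∑ i ∈ Finset.range (k + 3),
      C (signedArea (v ((i + (k + 3) - 1) % (k + 3))) (v i) (v ((i + 1) % (k + 3)))) *
        ∏ j ∈ ((Finset.range (k + 3)).erase i).erase ((i + 1) % (k + 3)),
          lineForm (v ((j + (k + 3) - 1) % (k + 3))) (v j) := by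
  have hpred (j : ℕ) (hj : j < k + 2) : (j + 1 + (k + 3) - 1) % (k + 3) = j := by
    rw [show j + 1 + (k + 3) - 1 = j + (k + 3) by omega, Nat.add_mod_right,
      Nat.mod_eq_of_lt (by omega)]
  have hzero : (0 + (k + 3) - 1) % (k + 3) = k + 2 := by
    rw [Nat.mod_eq_of_lt (by omega)]
    omega
  have hlast : (k + 2 + 1) % (k + 3) = 0 := Nat.mod_self _
  have hset (i : ℕ) (hi : i < k + 1) : ((Finset.range (k + 3)).erase (i + 1)).erase (i + 2) =
      insert 0 ((((Finset.range (k + 2)).erase i).erase (i + 1)).map (addRightEmbedding 1)) := by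
    ext j
    simp only [Finset.mem_erase, Finset.mem_range, Finset.mem_insert, Finset.mem_map,
      addRightEmbedding_apply]
    constructor
    · intro h
      rcases j with _ | j
      · exact Or.inl rfl
      · exact Or.inr ⟨j, by omega, rfl⟩
    · rintro (rfl | ⟨j, h, rfl⟩) <;> omega
  rw [Finset.sum_range_succ, Finset.sum_range_succ', vertexAdj, chainSum, Finset.mul_sum, hzero]
  refine congrArg₂ (· + ·) (congrArg₂ (· + ·) (Finset.sum_congr rfl fun i hi => ?_)
    (congrArg₂ (· * ·) ?_ ?_)) (congrArg₂ (· * ·) ?_ ?_)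
  · have hi := Finset.mem_range.1 hi
    rw [hpred i (by omega), Nat.mod_eq_of_lt (show i + 1 + 1 < k + 3 by omega), hset i hi,
      Finset.prod_insert (by simp), Finset.prod_map, hzero]
    have : ∏ j ∈ ((Finset.range (k + 2)).erase i).erase (i + 1),
        lineForm (v ((addRightEmbedding 1 j + (k + 3) - 1) % (k + 3)))
          (v (addRightEmbedding 1 j)) =
        ∏ j ∈ ((Finset.range (k + 2)).erase i).erase (i + 1), lineForm (v j) (v (j + 1)) := by
      refine Finset.prod_congr rfl fun j hj => ?_
      simp only [Finset.mem_erase, Finset.mem_range] at hj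
      rw [addRightEmbedding_apply, hpred j (by omega)]
    rw [this]
    ring
  · rw [Nat.mod_eq_of_lt (show 0 + 1 < k + 3 by omega)]
  · have : ((Finset.range (k + 3)).erase 0).erase ((0 + 1) % (k + 3)) =
        (Finset.range (k + 1)).map (addRightEmbedding 2) := by
      rw [Nat.mod_eq_of_lt (show 0 + 1 < k + 3 by omega)]
      ext j
      simp only [Finset.mem_erase, Finset.mem_range, Finset.mem_map, addRightEmbedding_apply]
      constructor
      · intro h
        exact ⟨j - 2, by omega, Nat.sub_add_cancel (by omega)⟩
      · rintro ⟨j, h, rfl⟩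
        omega
    rw [this, Finset.prod_map]
    refine Finset.prod_congr rfl fun j hj => ?_
    have hj := Finset.mem_range.1 hj
    rw [addRightEmbedding_apply, hpred (j + 1) (by omega)]
  · rw [hpred (k + 1) (by omega), hlast]
  · have : ((Finset.range (k + 3)).erase (k + 2)).erase 0 =
        (Finset.range (k + 1)).map (addRightEmbedding 1) := by
      ext j
      simp only [Finset.mem_erase, Finset.mem_range, Finset.mem_map, addRightEmbedding_apply]
      constructor
      · intro h
        exact ⟨j - 1, by omega, Nat.sub_add_cancel (by omega)⟩
      · rintro ⟨j, h, rfl⟩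
        omega
    rw [hlast, this, Finset.prod_map]
    refine Finset.prod_congr rfl fun j hj => ?_
    have hj := Finset.mem_range.1 hj
    rw [addRightEmbedding_apply, hpred j (by omega)]

theorem Nat.cyclic_pred_succ {m i : ℕ} (hi : i < m) : ((i + 1) % m + m - 1) % m = i := by
  rcases Nat.lt_or_ge (i + 1) m with h | h
  · rw [Nat.mod_eq_of_lt h, show i + 1 + m - 1 = i + m by omega, Nat.add_mod_right,
      Nat.mod_eq_of_lt hi]
  · obtain rfl : m = i + 1 := by omega
    rw [Nat.mod_self, Nat.mod_eq_of_lt (by omega)]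
    omega

namespace IsPolygonData

variable {m : ℕ} {v w : ℕ → Fin 2 → ℝ} {c : ℕ → ℝ}

theorem exists_scale (h : IsPolygonData m v w c) (i : ℕ) (hi : i < m) :
    ∃ s : ℝ, w i 0 = s * -(v i 1 - v ((i + m - 1) % m) 1) ∧
      w i 1 = s * (v i 0 - v ((i + m - 1) % m) 0) ∧
      linForm (w i) (c i) = C s * lineForm (v ((i + m - 1) % m)) (v i) := by
  refine exists_linForm_eq _ _ _ _ ?_ (h.vanish_prev i hi) (h.vanish_self i hi)
  intro heq
  have hm := h.three_le
  have h₁ : (i + 1) % m < m := Nat.mod_lt _ (by omega)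
  have h₀ : (i + m - 1) % m < m := Nat.mod_lt _ (by omega)
  have hi1 : (i + 1) % m = if i + 1 = m then 0 else i + 1 := by
    split_ifs with hc
    · rw [hc, Nat.mod_self]
    · exact Nat.mod_eq_of_lt (by omega)
  have hi0 : (i + m - 1) % m = if i = 0 then m - 1 else i - 1 := by
    split_ifs with hc
    · rw [hc, zero_add, Nat.mod_eq_of_lt (by omega)]
    · rw [show i + m - 1 = i - 1 + m by omega, Nat.add_mod_right, Nat.mod_eq_of_lt (by omega)]
  have hpos := h.pos_other ((i + 1) % m) h₁ ((i + m - 1) % m) h₀ ?_ ?_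
  · have hv := h.vanish_prev ((i + 1) % m) h₁
    rw [Nat.cyclic_pred_succ hi, ← heq] at hv
    exact hpos.ne' hv
  · rw [Nat.cyclic_pred_succ hi, hi0]
    split_ifs <;> omega
  · rw [hi0, hi1]
    split_ifs <;> omega

theorem signedArea_ne_zero (h : IsPolygonData m v w c) (i : ℕ) (hi : i + 2 < m) :
    signedArea (v (i + 1)) (v (i + 2)) (v 0) ≠ 0 := by
  have hprev : (i + 2 + m - 1) % m = i + 1 := by
    rw [show i + 2 + m - 1 = i + 1 + m by omega, Nat.add_mod_right, Nat.mod_eq_of_lt (by omega)]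
  obtain ⟨s, -, -, hs⟩ := h.exists_scale (i + 2) hi
  have hpos := h.pos_other (i + 2) hi 0 (by omega) (by omega) (by omega)
  rw [hs, hprev, map_mul, eval_lineForm] at hpos
  exact right_ne_zero_of_mul hpos.ne'

end IsPolygonData

theorem IsAdjointOf.exists_eq_vertexAdj {k : ℕ} {v : ℕ → Fin 2 → ℝ}
    {p : MvPolynomial (Fin 2) ℝ} (h : IsAdjointOf (k + 3) v p) :
    ∃ s : ℝ, s ≠ 0 ∧ p = C s * vertexAdj v (k + 1) := by
  obtain ⟨w, c, hd, rfl⟩ := h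
  choose! s hs₀ hs₁ hs using hd.exists_scale
  have hnext (i : ℕ) : (i + 1) % (k + 3) < k + 3 := Nat.mod_lt _ (by omega)
  have hdet (i : ℕ) (hi : i < k + 3) : det2 (w i) (w ((i + 1) % (k + 3))) =
      s i * s ((i + 1) % (k + 3)) *
        signedArea (v ((i + (k + 3) - 1) % (k + 3))) (v i) (v ((i + 1) % (k + 3))) := by
    rw [det2, hs₀ i hi, hs₁ i hi, hs₀ _ (hnext i), hs₁ _ (hnext i),
      Nat.cyclic_pred_succ hi, signedArea]
    ring
  refine ⟨∏ j ∈ Finset.range (k + 3), s j, Finset.prod_ne_zero_iff.2 fun i hi => ?_, ?_⟩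
  · have hi := Finset.mem_range.1 hi
    have := hd.ccw i hi
    rw [hdet i hi] at this
    exact left_ne_zero_of_mul (left_ne_zero_of_mul this.ne')
  · rw [vertexAdj_eq_sum, adjPoly, Finset.mul_sum]
    refine Finset.sum_congr rfl fun i hi => ?_
    have hi' := Finset.mem_range.1 hi
    have hmem : (i + 1) % (k + 3) ∈ (Finset.range (k + 3)).erase i := by
      refine Finset.mem_erase.2 ⟨?_, Finset.mem_range.2 (hnext i)⟩
      rcases Nat.lt_or_ge (i + 1) (k + 3) with h | h
      · rw [Nat.mod_eq_of_lt h]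
        omega
      · obtain rfl : i = k + 2 := by omega
        rw [Nat.mod_self]
        omega
    rw [hdet i hi', ← Finset.mul_prod_erase _ _ hi, ← Finset.mul_prod_erase _ _ hmem,
      Finset.prod_congr rfl fun j hj =>
        hs j (Finset.mem_range.1 (Finset.mem_of_mem_erase (Finset.mem_of_mem_erase hj))),
      Finset.prod_mul_distrib]
    simp only [C_mul, map_prod]
    ring

theorem stmt_5 (n : ℕ) (hn : 4 ≤ n) (v : ℕ → Fin 2 → ℝ)
    (A : Fin (n - 3) → MvPolynomial (Fin 2) ℝ)
    (hA : ∀ k : Fin (n - 3), IsAdjointOf (k.val + 4) v (A k))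
    (hsmooth : ¬ ∃ z : Fin 3 → ℂ, z ≠ 0 ∧ ∀ i : Fin 3,
      aeval z (pderiv i (homogenize (n - 3) (A ⟨n - 4, by omega⟩))) = 0) :
    ∃ (M : Matrix (Fin (n - 3)) (Fin (n - 3)) (MvPolynomial (Fin 2) ℝ))
      (c : Fin (n - 3) → ℝ),
      (∀ k, c k ≠ 0) ∧
      M.IsSymm ∧
      (∀ i j, (M i j).totalDegree ≤ 1) ∧
      (∀ i j : Fin (n - 3), (i.val + 2 ≤ j.val ∨ j.val + 2 ≤ i.val) → M i j = 0) ∧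
      (∀ k : Fin (n - 3),
        (M.submatrix (Fin.castLE k.isLt) (Fin.castLE k.isLt)).det = C (c k) * A k) := by
  have hne (k : Fin (n - 3)) (i : ℕ) (hi : i < k.val + 2) :
      signedArea (v (i + 1)) (v (i + 2)) (v 0) ≠ 0 := by
    obtain ⟨w, c, hd, -⟩ := hA k
    exact hd.signedArea_ne_zero i (by omega)
  choose s hs hAs using fun k : Fin (n - 3) =>
    IsAdjointOf.exists_eq_vertexAdj (k := k.val + 1) (hA k)
  have htri : signedArea (v 0) (v 1) (v 2) ≠ 0 := by
    intro h0
    apply hne ⟨0, by omega⟩ 0 (by simp)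
    rw [← h0]
    simp only [signedArea]
    ring
  refine ⟨symmTridiagonal (fun i => recDiag (v (i + 1)) (v (i + 2)) (v (i + 3)) (v 0))
    (fun i => recOffDiag (v (i + 1)) (v (i + 2)) (v (i + 3)) (v 0)) (n - 3),
    fun k => (s k * signedArea (v 0) (v 1) (v 2) ^ 2)⁻¹, fun k => ?_,
    symmTridiagonal_isSymm _ _ _, fun i j => ?_, fun i j hij => ?_, fun k => ?_⟩
  · exact inv_ne_zero (mul_ne_zero (hs k) (pow_ne_zero 2 htri))
  · simp only [symmTridiagonal, Matrix.of_apply]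
    split_ifs
    · exact totalDegree_recDiag_le _ _ _ _
    · exact totalDegree_recOffDiag_le _ _ _ _
    · exact totalDegree_recOffDiag_le _ _ _ _
    · simp
  · simp only [symmTridiagonal, Matrix.of_apply]
    rw [if_neg (by omega), if_neg (by omega), if_neg (by omega)]
  · rw [symmTridiagonal_submatrix_castLE, hAs k, vertexAdj_eq_det v (k.val + 1) (hne k),
      ← mul_assoc, ← mul_assoc, ← C_mul, ← C_mul, mul_assoc,
      inv_mul_cancel₀ (mul_ne_zero (hs k) (pow_ne_zero 2 htri)), C_1, one_mul]
end

section
/- Let P = conv(v_1,…,v_n), n ≥ 5, be a convex polygon as in the context, and assume that the facet lines L_1, …, L_n (where L_i = {x ∈ ℝ² : l_i(x) = 0}) are pairwise non-parallel and no three of them pass through a common point. Let P' = conv(v_1, …, v_{n−1}) be the polygon obtained by removing the vertex v_n, with adjoint α_{P'}. For 2 ≤ i < j ≤ n−1 with j ≥ i + 2, let q_{ij} ∈ ℝ² be the intersection point of L_i and L_j. Then the set of common zeros in ℙ²(ℂ) of the homogenizations of α_P and α_{P'} is exactly { (1 : q_{ij}) : 2 ≤ i, i + 2 ≤ j ≤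 n − 1 }, and moreover at each such point q_{ij} the gradients ∇α_P(q_{ij}) and ∇α_{P'}(q_{ij}) are nonzero and parallel (the two adjoint curves are tangent there, so each intersection point has multiplicity two). -/
open MvPolynomial

theorem succ_mod_eq {m i : ℕ} (hi : i < m) :
    (i + 1) % m = if i + 1 = m then 0 else i + 1 := by
  split_ifs with h
  · rw [h, Nat.mod_self]
  · exact Nat.mod_eq_of_lt (by omega)

theorem pred_mod_eq {m i : ℕ} (hi : i < m) :
    (i + m - 1) % m = if i = 0 then m - 1 else i - 1 := by
  split_ifs with h
  · subst h
    rw [Nat.zero_add]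
    exact Nat.mod_eq_of_lt (by omega)
  · rw [show i + m - 1 = (i - 1) + m by omega, Nat.add_mod_right]
    exact Nat.mod_eq_of_lt (by omega)

theorem eval_linForm (w : Fin 2 → ℝ) (c : ℝ) (x : Fin 2 → ℝ) :
    eval x (linForm w c) = c + w 0 * x 0 + w 1 * x 1 := by
  simp [linForm]

theorem aeval_linForm (w : Fin 2 → ℝ) (c : ℝ) (x : Fin 2 → ℂ) :
    aeval x (linForm w c) = c + w 0 * x 0 + w 1 * x 1 := by
  simp [linForm]

theorem pderiv_linForm (w : Fin 2 → ℝ) (c : ℝ) (d : Fin 2) :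
    pderiv d (linForm w c) = C (w d) := by
  fin_cases d <;> simp [linForm, pderiv_X]

theorem totalDegree_linForm_le (w : Fin 2 → ℝ) (c : ℝ) : (linForm w c).totalDegree ≤ 1 := by
  unfold linForm
  refine (totalDegree_add _ _).trans (max_le ((totalDegree_add _ _).trans (max_le ?_ ?_)) ?_)
  · simp
  · exact (totalDegree_mul _ _).trans (by simp)
  · exact (totalDegree_mul _ _).trans (by simp)

theorem totalDegree_prod_linForm_le (s : Finset ℕ) (w : ℕ → Fin 2 → ℝ) (c : ℕ → ℝ) :
    (∏ j ∈ s, linForm (w j) (c j)).totalDegree ≤ s.card := by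
  refine (totalDegree_finsetProd _ _).trans ?_
  simpa using Finset.sum_le_sum fun j (_ : j ∈ s) => totalDegree_linForm_le (w j) (c j)

theorem sum_range_succ_mod {M : Type*} [AddCommMonoid M] {m : ℕ} (hm : 0 < m) (g : ℕ → M) :
    ∑ k ∈ Finset.range m, g ((k + 1) % m) = ∑ k ∈ Finset.range m, g k := by
  obtain ⟨m, rfl⟩ : ∃ k, m = k + 1 := ⟨m - 1, by omega⟩
  rw [Finset.sum_range_succ, Finset.sum_range_succ' g, Nat.mod_self]
  congr 1
  refine Finset.sum_congr rfl fun k hk => ?_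
  rw [Nat.mod_eq_of_lt]
  have := Finset.mem_range.mp hk
  omega

theorem mul_prod_erase_erase {M : Type*} [CommMonoid M] (f : ℕ → M) {s : Finset ℕ} {a b : ℕ}
    (hb : b ∈ s) (hab : a ≠ b) :
    f b * ∏ j ∈ (s.erase a).erase b, f j = ∏ j ∈ s.erase a, f j :=
  Finset.mul_prod_erase _ f (Finset.mem_erase.mpr ⟨hab.symm, hb⟩)

/-- Multiplication by the second coordinate makes the sum defining the adjoint telescope,
up to terms of degree `m - 2`. -/
theorem totalDegree_adjPoly_le {m : ℕ} (hm : 3 ≤ m) (w : ℕ → Fin 2 → ℝ) (c : ℕ → ℝ) :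
    (adjPoly m w c).totalDegree ≤ m - 3 := by
  have key : adjPoly m w c * X 1 = - ∑ i ∈ Finset.range m,
      C (w i 0 * c ((i + 1) % m) - w ((i + 1) % m) 0 * c i) *
      ∏ j ∈ ((Finset.range m).erase i).erase ((i + 1) % m), linForm (w j) (c j) := by
    have tele := sum_range_succ_mod (m := m) (by omega)
      fun k => C (w k 0) * ∏ j ∈ (Finset.range m).erase k, linForm (w j) (c j)
    rw [eq_neg_iff_add_eq_zero, adjPoly, Finset.sum_mul, ← Finset.sum_add_distrib,
      ← sub_eq_zero.mpr tele.symm, ← Finset.sum_sub_distrib]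
    refine Finset.sum_congr rfl fun i hi => ?_
    have hi' := Finset.mem_range.mp hi
    have hs : (i + 1) % m ∈ Finset.range m := Finset.mem_range.mpr (Nat.mod_lt _ (by omega))
    have hne : i ≠ (i + 1) % m := by
      rw [succ_mod_eq hi']; split_ifs <;> omega
    rw [← mul_prod_erase_erase (fun j => linForm (w j) (c j)) hs hne,
      ← mul_prod_erase_erase (fun j => linForm (w j) (c j)) hi hne.symm,
      Finset.erase_right_comm (a := (i + 1) % m)]
    simp only [det2, linForm, map_sub, map_mul]
    ring
  by_cases h0 : adjPoly m w c = 0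
  · simp [h0]
  have h1 := totalDegree_mul_of_isDomain h0 (X_ne_zero (R := ℝ) (1 : Fin 2))
  rw [totalDegree_X] at h1
  have h2 : (adjPoly m w c * X 1).totalDegree ≤ m - 2 := by
    rw [key, totalDegree_neg]
    refine totalDegree_finsetSum_le fun i hi => ?_
    refine (totalDegree_mul _ _).trans ?_
    rw [totalDegree_C, zero_add]
    refine (totalDegree_prod_linForm_le _ _ _).trans ?_
    have hi' := Finset.mem_range.mp hi
    rw [Finset.card_erase_of_mem, Finset.card_erase_of_mem hi, Finset.card_range]
    · omega
    · rw [Finset.mem_erase, Finset.mem_range, succ_mod_eq hi']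
      split_ifs <;> omega
  omega

/-- The index set of the facets of an `m`-gon that are not adjacent to the facet `i`. -/
def farIndices (m i : ℕ) : Finset ℕ :=
  (((Finset.range m).erase i).erase ((i + 1) % m)).erase ((i + m - 1) % m)

theorem mem_farIndices {m i k : ℕ} :
    k ∈ farIndices m i ↔ k < m ∧ k ≠ i ∧ k ≠ (i + 1) % m ∧ k ≠ (i + m - 1) % m := by
  simp only [farIndices, Finset.mem_erase, Finset.mem_range]
  tauto

theorem card_farIndices {m i : ℕ} (hm : 3 ≤ m) (hi : i < m) :
    (farIndices m i).card = m - 3 := by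
  have hs := succ_mod_eq hi
  have hp := pred_mod_eq hi
  rw [farIndices, Finset.card_erase_of_mem, Finset.card_erase_of_mem, Finset.card_erase_of_mem,
    Finset.card_range]
  · omega
  · simpa using hi
  · rw [Finset.mem_erase, Finset.mem_range, hs]
    split_ifs <;> omega
  · simp only [Finset.mem_erase, Finset.mem_range, hs, hp]
    split_ifs <;> omega

/-- Restricted to a facet line, the adjoint is a nonzero multiple of the product of the
forms of the non-adjacent facets. -/
theorem IsPolygonData.exists_adjPoly_eq {m : ℕ} {v w : ℕ → Fin 2 → ℝ} {c : ℕ → ℝ}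
    (h : IsPolygonData m v w c) {i : ℕ} (hi : i < m) :
    ∃ K : ℝ, K ≠ 0 ∧ ∃ R, adjPoly m w c =
      C K * ∏ j ∈ farIndices m i, linForm (w j) (c j) + linForm (w i) (c i) * R := by
  have hm := h.three_le
  obtain ⟨s, hs⟩ : ∃ s, s = (i + 1) % m := ⟨_, rfl⟩
  obtain ⟨p, hp⟩ : ∃ p, p = (i + m - 1) % m := ⟨_, rfl⟩
  have hs' := succ_mod_eq hi
  have hp' := pred_mod_eq hi
  rw [← hs] at hs'
  rw [← hp] at hp'
  have hsm : s < m := by split_ifs at hs' <;> omega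
  have hpm : p < m := by split_ifs at hp' <;> omega
  have hsi : s ≠ i := by split_ifs at hs' <;> omega
  have hpi : p ≠ i := by split_ifs at hp' <;> omega
  have hsp : s ≠ p := by split_ifs at hp' hs' <;> omega
  have hps : (p + 1) % m = i := by
    rw [succ_mod_eq hpm]; split_ifs at hp' ⊢ <;> omega
  have hsp' : (s + m - 1) % m = i := by
    rw [pred_mod_eq hsm]; split_ifs at hs' ⊢ <;> omega
  refine ⟨det2 (w p) (w i) * c s + det2 (w i) (w s) * c p + det2 (w s) (w p) * c i, ?_, ?_⟩
  · have e1 := h.vanish_prev i hi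
    have e2 := h.vanish_self p hpm
    have e3 := h.pos_other s hsm p hpm (by rw [hsp']; exact hpi) hsp.symm
    have e4 := h.ccw p hpm
    rw [← hp] at e1
    rw [hps] at e4
    rw [eval_linForm] at e1 e2 e3
    have : det2 (w p) (w i) * c s + det2 (w i) (w s) * c p + det2 (w s) (w p) * c i =
        det2 (w p) (w i) * (c s + w s 0 * v p 0 + w s 1 * v p 1) := by
      simp only [det2]
      linear_combination (w i 0 * w s 1 - w i 1 * w s 0) * e2 +
        (w s 0 * w p 1 - w s 1 * w p 0) * e1
    rw [this]
    positivity
  have hdvd : linForm (w i) (c i) ∣ ∑ k ∈ ((Finset.range m).erase i).erase p,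
      C (det2 (w k) (w ((k + 1) % m))) *
      ∏ j ∈ ((Finset.range m).erase k).erase ((k + 1) % m), linForm (w j) (c j) := by
    refine Finset.dvd_sum fun k hk => Dvd.dvd.mul_left (Finset.dvd_prod_of_mem _ ?_) _
    simp only [Finset.mem_erase, Finset.mem_range] at hk ⊢
    refine ⟨?_, by omega, hi⟩
    rw [succ_mod_eq hk.2.2]
    split_ifs at hp' ⊢ <;> omega
  obtain ⟨R, hR⟩ := hdvd
  refine ⟨R - C (det2 (w s) (w p)) * ∏ j ∈ farIndices m i, linForm (w j) (c j), ?_⟩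
  have hfi : ∏ j ∈ ((Finset.range m).erase i).erase s, linForm (w j) (c j) =
      linForm (w p) (c p) * ∏ j ∈ farIndices m i, linForm (w j) (c j) := by
    rw [farIndices, ← hs, ← hp]
    refine (Finset.mul_prod_erase _ (fun j => linForm (w j) (c j)) ?_).symm
    simp only [Finset.mem_erase, Finset.mem_range]
    omega
  have hfp : ∏ j ∈ ((Finset.range m).erase p).erase i, linForm (w j) (c j) =
      linForm (w s) (c s) * ∏ j ∈ farIndices m i, linForm (w j) (c j) := by
    have : farIndices m i = (((Finset.range m).erase p).erase i).erase s := by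
      ext k
      simp only [farIndices, ← hs, ← hp, Finset.mem_erase, Finset.mem_range]
      tauto
    rw [this]
    refine (Finset.mul_prod_erase _ (fun j => linForm (w j) (c j)) ?_).symm
    simp only [Finset.mem_erase, Finset.mem_range]
    omega
  rw [adjPoly, ← Finset.add_sum_erase _ _ (Finset.mem_range.mpr hi),
    ← Finset.add_sum_erase _ _ (Finset.mem_erase.mpr ⟨hpi, Finset.mem_range.mpr hpm⟩), hR,
    ← hs, hps, hfi, hfp]
  simp only [det2, linForm, map_sub, map_mul, map_add]
  ring

/-- The homogenized affine form `c x₀ + w₀ x₁ + w₁ x₂` as a function on `ℂ³`. -/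
noncomputable def projForm (w : Fin 2 → ℝ) (c : ℝ) (z : Fin 3 → ℂ) : ℂ :=
  c * z 0 + w 0 * z 1 + w 1 * z 2

theorem mul_aeval_linForm (w : Fin 2 → ℝ) (c : ℝ) {z : Fin 3 → ℂ} (hz : z 0 ≠ 0) :
    z 0 * aeval ![z 1 / z 0, z 2 / z 0] (linForm w c) = projForm w c z := by
  rw [aeval_linForm, projForm]
  simp
  field_simp

theorem aeval_homogenize {d : ℕ} {p : MvPolynomial (Fin 2) ℝ} (hp : p.totalDegree ≤ d)
    {z : Fin 3 → ℂ} (hz : z 0 ≠ 0) :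
    aeval z (homogenize d p) = z 0 ^ d * aeval ![z 1 / z 0, z 2 / z 0] p := by
  rw [aeval_def _ p, eval₂_eq', homogenize, map_sum, Finset.mul_sum]
  refine Finset.sum_congr rfl fun e he => ?_
  have hdeg : e 0 + e 1 ≤ d := by
    refine le_trans ?_ ((le_totalDegree he).trans hp)
    rw [Finsupp.sum_fintype _ _ (by simp), Fin.sum_univ_two]
  simp only [map_mul, map_pow, aeval_X, aeval_C, Fin.prod_univ_two, Matrix.cons_val_zero,
    Matrix.cons_val_one]
  rw [← Nat.sub_add_cancel hdeg, pow_add, pow_add]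
  simp only [Nat.add_sub_cancel, div_pow]
  field_simp

theorem continuous_aeval_complex (p : MvPolynomial (Fin 3) ℝ) :
    Continuous fun z : Fin 3 → ℂ => aeval z p := by
  simp only [aeval_def, eval₂_eq_eval_map]
  exact continuous_eval _

/-- An identity between continuous functions on `ℂ³` that holds on a punctured line extends
to the missing point. -/
theorem eq_of_eq_punctured_line {F G : (Fin 3 → ℂ) → ℂ} (hF : Continuous F) (hG : Continuous G)
    {z u : Fin 3 → ℂ}
    (h : ∀ t : ℂ, t ≠ 0 → F (z + t • u) = G (z + t • u)) : F z = G z := by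
  have hc : Continuous fun t : ℂ => z + t • u := by fun_prop
  have := Continuous.ext_on (dense_compl_singleton (0 : ℂ)) (hF.comp hc) (hG.comp hc)
    (fun t ht => h t ht)
  simpa using congrFun this 0

theorem pow_card_mul_aeval_prod_linForm (s : Finset ℕ) (w : ℕ → Fin 2 → ℝ) (c : ℕ → ℝ)
    {z : Fin 3 → ℂ} (hz : z 0 ≠ 0) :
    z 0 ^ s.card * aeval ![z 1 / z 0, z 2 / z 0] (∏ j ∈ s, linForm (w j) (c j)) =
      ∏ j ∈ s, projForm (w j) (c j) z := by
  rw [map_prod, ← Finset.prod_const, ← Finset.prod_mul_distrib]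
  exact Finset.prod_congr rfl fun j _ => mul_aeval_linForm _ _ hz

theorem continuous_projForm (w : Fin 2 → ℝ) (c : ℝ) : Continuous (projForm w c) := by
  unfold projForm
  fun_prop

theorem IsPolygonData.exists_homogenize_eq {m : ℕ} {v w : ℕ → Fin 2 → ℝ} {c : ℕ → ℝ}
    (h : IsPolygonData m v w c) {i : ℕ} (hi : i < m) :
    ∃ K : ℝ, K ≠ 0 ∧ ∀ z : Fin 3 → ℂ, projForm (w i) (c i) z = 0 →
      aeval z (homogenize (m - 3) (adjPoly m w c)) =
        K * ∏ j ∈ farIndices m i, projForm (w j) (c j) z := by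
  obtain ⟨K, hK, R, hR⟩ := h.exists_adjPoly_eq hi
  refine ⟨K, hK, ?_⟩
  have affine : ∀ z : Fin 3 → ℂ, z 0 ≠ 0 → projForm (w i) (c i) z = 0 →
      aeval z (homogenize (m - 3) (adjPoly m w c)) =
        K * ∏ j ∈ farIndices m i, projForm (w j) (c j) z := by
    intro z hz hzi
    rw [← mul_aeval_linForm _ _ hz] at hzi
    have hzi' := (mul_eq_zero.mp hzi).resolve_left hz
    rw [aeval_homogenize (totalDegree_adjPoly_le h.three_le w c) hz, hR, map_add, map_mul,
      map_mul, hzi', zero_mul, add_zero, ← pow_card_mul_aeval_prod_linForm _ _ _ hz,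
      card_farIndices h.three_le hi, aeval_C, Complex.coe_algebraMap]
    ring
  intro z hzi
  by_cases hz : z 0 = 0
  · have hv := h.vanish_self i hi
    rw [eval_linForm] at hv
    have hv' : (c i : ℂ) + w i 0 * v i 0 + w i 1 * v i 1 = 0 := by exact_mod_cast hv
    refine eq_of_eq_punctured_line (F := fun z => aeval z (homogenize (m - 3) (adjPoly m w c)))
      (G := fun z => K * ∏ j ∈ farIndices m i, projForm (w j) (c j) z)
      (u := ![1, (v i 0 : ℂ), (v i 1 : ℂ)]) (continuous_aeval_complex _)
      (continuous_const.mul (continuous_finsetProd _ fun j _ => continuous_projForm _ _))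
      fun t ht => affine _ (by simpa [hz] using ht) ?_
    unfold projForm at hzi ⊢
    simp
    linear_combination hzi + t * hv'
  · exact affine z hz hzi

theorem C_det2_cyclic (a b d : Fin 2 → ℝ) (p q r : ℝ) :
    C (det2 a b) * linForm d r + C (det2 b d) * linForm a p + C (det2 d a) * linForm b q =
      C (det2 a b * r + det2 b d * p + det2 d a * q) := by
  simp only [det2, linForm, map_sub, map_mul, map_add]
  ring

theorem det2_cyclic_eq {a b d : Fin 2 → ℝ} {p q : ℝ} (r : ℝ) {x : Fin 2 → ℝ}
    (ha : eval x (linForm a p) = 0) (hb : eval x (linForm b q) = 0) :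
    det2 a b * r + det2 b d * p + det2 d a * q = det2 a b * eval x (linForm d r) := by
  rw [eval_linForm] at *
  simp only [det2]
  linear_combination (b 0 * d 1 - b 1 * d 0) * ha + (d 0 * a 1 - d 1 * a 0) * hb

theorem C_det2_cyclic_eq_zero {a b d : Fin 2 → ℝ} {p q r : ℝ} {x : Fin 2 → ℝ}
    (ha : eval x (linForm a p) = 0) (hb : eval x (linForm b q) = 0)
    (hd : eval x (linForm d r) = 0) :
    C (det2 a b) * linForm d r + C (det2 b d) * linForm a p + C (det2 d a) * linForm b q = 0 := by
  rw [C_det2_cyclic, det2_cyclic_eq r ha hb, hd, mul_zero, map_zero]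

theorem det2_ne_zero_of_eval {a b : Fin 2 → ℝ} {p q : ℝ} {x y : Fin 2 → ℝ}
    (hax : eval x (linForm a p) = 0) (hay : eval y (linForm a p) ≠ 0)
    (hbx : eval x (linForm b q) = 0) (hby : eval y (linForm b q) = 0) (hb : b ≠ 0) :
    det2 a b ≠ 0 := by
  intro h
  rw [eval_linForm] at *
  rw [det2] at h
  apply hb
  have e : ∀ d, b d = 0 := by
    rw [Fin.forall_fin_two]
    constructor <;> refine (mul_eq_zero.mp ?_).resolve_left hay
    · linear_combination a 0 * hby - a 0 * hbx + b 0 * hax - (y 1 - x 1) * h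
    · linear_combination a 1 * hby - a 1 * hbx + b 1 * hax + (y 0 - x 0) * h
  exact funext e

theorem IsPolygonData.normal_ne_zero {m : ℕ} {v w : ℕ → Fin 2 → ℝ} {c : ℕ → ℝ}
    (h : IsPolygonData m v w c) {i : ℕ} (hi : i < m) : w i ≠ 0 := by
  intro h0
  simpa [h0, det2] using h.ccw i hi

/-- Facet forms of an edge shared by a polygon and the subpolygon obtained by removing the
last vertex differ by a positive factor. -/
theorem IsPolygonData.exists_scale_s7 {m : ℕ} {v w w' : ℕ → Fin 2 → ℝ} {c c' : ℕ → ℝ}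
    (h : IsPolygonData (m + 1) v w c) (h' : IsPolygonData m v w' c') {i : ℕ} (h1 : 1 ≤ i)
    (hi : i < m) : ∃ s : ℝ, s ≠ 0 ∧ w' i = s • w i ∧ c' i = s * c i := by
  have hm := h'.three_le
  have a1 := h.vanish_prev i (by omega)
  have a2 := h.vanish_self i (by omega)
  have b1 := h'.vanish_prev i hi
  have b2 := h'.vanish_self i hi
  rw [pred_mod_eq (by omega), if_neg (by omega)] at a1 b1
  have d1 := h.vanish_prev (i + 1) (by omega)
  have d2 := h.pos_other (i + 1) (by omega) (i - 1) (by omega)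
    (by rw [pred_mod_eq (by omega)]; split_ifs <;> omega) (by omega)
  rw [pred_mod_eq (by omega), if_neg (by omega), Nat.add_sub_cancel] at d1
  have hw := h.normal_ne_zero (i := i) (by omega)
  have hw' := h'.normal_ne_zero hi
  have hdet : det2 (w' i) (w i) = 0 := by
    by_contra hne
    have hx := det2_cyclic_eq (d := w (i + 1)) (c (i + 1)) b2 a2
    have hy := det2_cyclic_eq (d := w (i + 1)) (c (i + 1)) b1 a1
    rw [d1] at hx
    exact d2.ne' (by simpa [hne] using hy.symm.trans hx)
  rw [det2] at hdet
  have hsq : w i 0 ^ 2 + w i 1 ^ 2 ≠ 0 := by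
    intro h0
    apply hw
    have e0 : w i 0 = 0 := by nlinarith [sq_nonneg (w i 0), sq_nonneg (w i 1)]
    have e1 : w i 1 = 0 := by nlinarith [sq_nonneg (w i 0), sq_nonneg (w i 1)]
    funext d
    fin_cases d
    · exact e0
    · exact e1
  have hws : w' i = ((w' i 0 * w i 0 + w' i 1 * w i 1) / (w i 0 ^ 2 + w i 1 ^ 2)) • w i := by
    funext d
    fin_cases d <;> simp <;> field_simp
    · linear_combination w i 1 * hdet
    · linear_combination -w i 0 * hdet
  generalize (w' i 0 * w i 0 + w' i 1 * w i 1) / (w i 0 ^ 2 + w i 1 ^ 2) = s at hws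
  refine ⟨s, ?_, hws, ?_⟩
  · rintro rfl
    exact hw' (by rw [hws, zero_smul])
  · rw [eval_linForm] at a2 b2
    rw [hws] at b2
    simp only [Pi.smul_apply, smul_eq_mul] at b2
    linear_combination b2 - s * a2

theorem linForm_smul (s : ℝ) (w : Fin 2 → ℝ) (c : ℝ) :
    linForm (s • w) (s * c) = C s * linForm w c := by
  simp [linForm]
  ring

theorem adjPoly_smul {m : ℕ} (hm : 2 ≤ m) {w w' : ℕ → Fin 2 → ℝ} {c c' : ℕ → ℝ} {s : ℕ → ℝ}
    (hs : ∀ i < m, w' i = s i • w i ∧ c' i = s i * c i) :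
    adjPoly m w' c' = C (∏ i ∈ Finset.range m, s i) * adjPoly m w c := by
  rw [adjPoly, adjPoly, Finset.mul_sum]
  refine Finset.sum_congr rfl fun i hi => ?_
  have hi' := Finset.mem_range.mp hi
  have hlt : (i + 1) % m < m := Nat.mod_lt _ (by omega)
  have hmem : (i + 1) % m ∈ (Finset.range m).erase i := by
    rw [Finset.mem_erase, Finset.mem_range]
    refine ⟨?_, hlt⟩
    rw [succ_mod_eq hi']
    split_ifs <;> omega
  rw [← Finset.mul_prod_erase _ s hi, ← Finset.mul_prod_erase _ s hmem,
    Finset.prod_congr rfl fun j hj => ?_, Finset.prod_mul_distrib, (hs i hi').1, (hs _ hlt).1,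
    map_mul, map_mul, map_prod]
  rotate_left 3
  · have hj' : j < m := by simp at hj; omega
    rw [(hs j hj').1, (hs j hj').2, linForm_smul]
  simp only [det2, Pi.smul_apply, smul_eq_mul, map_sub, map_mul]
  ring

theorem cyclic_sum_eq {R : Type*} [CommRing R] (N : ℕ) (d : ℕ → ℕ → R) (f : ℕ → R) :
    ∑ i ∈ Finset.range (N + 4), d i ((i + 1) % (N + 4)) *
      ∏ j ∈ ((Finset.range (N + 4)).erase i).erase ((i + 1) % (N + 4)), f j =
    f 0 * (∑ k ∈ Finset.range (N + 2), d (k + 1) (k + 2) *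
      ∏ j ∈ ((Finset.Icc 1 (N + 3)).erase (k + 1)).erase (k + 2), f j) +
    d 0 1 * (f (N + 3) * ∏ j ∈ Finset.Icc 2 (N + 2), f j) +
    d (N + 3) 0 * (f 1 * ∏ j ∈ Finset.Icc 2 (N + 2), f j) := by
  rw [Finset.sum_range_succ, Finset.sum_range_succ', Finset.mul_sum, Nat.mod_self,
    Nat.mod_eq_of_lt (show 0 + 1 < N + 4 by omega),
    show ((Finset.range (N + 4)).erase 0).erase (0 + 1) =
      insert (N + 3) (Finset.Icc 2 (N + 2)) by ext; simp; omega,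
    show ((Finset.range (N + 4)).erase (N + 3)).erase 0 =
      insert 1 (Finset.Icc 2 (N + 2)) by ext; simp; omega,
    Finset.prod_insert (by simp), Finset.prod_insert (by simp)]
  congr 2
  refine Finset.sum_congr rfl fun k hk => ?_
  have hk' := Finset.mem_range.mp hk
  rw [Nat.mod_eq_of_lt (show k + 1 + 1 < N + 4 by omega),
    show ((Finset.range (N + 4)).erase (k + 1)).erase (k + 1 + 1) =
      insert 0 (((Finset.Icc 1 (N + 3)).erase (k + 1)).erase (k + 2)) by ext; simp; omega,
    Finset.prod_insert (by simp)]
  ring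

theorem cyclic_sum_succ_eq {R : Type*} [CommRing R] (N : ℕ) (d : ℕ → ℕ → R) (f : ℕ → R) :
    ∑ i ∈ Finset.range (N + 5), d i ((i + 1) % (N + 5)) *
      ∏ j ∈ ((Finset.range (N + 5)).erase i).erase ((i + 1) % (N + 5)), f j =
    f 0 * f (N + 4) * (∑ k ∈ Finset.range (N + 2), d (k + 1) (k + 2) *
      ∏ j ∈ ((Finset.Icc 1 (N + 3)).erase (k + 1)).erase (k + 2), f j) +
    d 0 1 * (f (N + 3) * (f (N + 4) * ∏ j ∈ Finset.Icc 2 (N + 2), f j)) +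
    d (N + 3) (N + 4) * (f 0 * (f 1 * ∏ j ∈ Finset.Icc 2 (N + 2), f j)) +
    d (N + 4) 0 * (f 1 * (f (N + 3) * ∏ j ∈ Finset.Icc 2 (N + 2), f j)) := by
  rw [Finset.sum_range_succ, Finset.sum_range_succ, Finset.sum_range_succ', Finset.mul_sum,
    Nat.mod_self, Nat.mod_eq_of_lt (show 0 + 1 < N + 5 by omega),
    Nat.mod_eq_of_lt (show N + 3 + 1 < N + 5 by omega),
    show ((Finset.range (N + 5)).erase 0).erase (0 + 1) =
      insert (N + 3) (insert (N + 4) (Finset.Icc 2 (N + 2))) by ext; simp; omega,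
    show ((Finset.range (N + 5)).erase (N + 3)).erase (N + 3 + 1) =
      insert 0 (insert 1 (Finset.Icc 2 (N + 2))) by ext; simp; omega,
    show ((Finset.range (N + 5)).erase (N + 4)).erase 0 =
      insert 1 (insert (N + 3) (Finset.Icc 2 (N + 2))) by ext; simp; omega]
  repeat rw [Finset.prod_insert (by simp)]
  congr 3
  refine Finset.sum_congr rfl fun k hk => ?_
  have hk' := Finset.mem_range.mp hk
  rw [Nat.mod_eq_of_lt (show k + 1 + 1 < N + 5 by omega),
    show ((Finset.range (N + 5)).erase (k + 1)).erase (k + 1 + 1) = insert 0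
      (insert (N + 4) (((Finset.Icc 1 (N + 3)).erase (k + 1)).erase (k + 2))) by
      ext; simp; omega,
    Finset.prod_insert (by simp), Finset.prod_insert (by simp)]
  ring

/-- Removing the last vertex: the adjoints of a polygon and of the subpolygon are related by the
forms of the two removed facets and of the new facet. -/
theorem adjPoly_relation_of_eq {N : ℕ} {w w' : ℕ → Fin 2 → ℝ} {c c' : ℕ → ℝ} {x y : Fin 2 → ℝ}
    (hw : ∀ i, 1 ≤ i → i < N + 4 → w' i = w i ∧ c' i = c i)
    (hx0 : eval x (linForm (w 0) (c 0)) = 0) (hx1 : eval x (linForm (w 1) (c 1)) = 0)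
    (hx : eval x (linForm (w' 0) (c' 0)) = 0)
    (hy3 : eval y (linForm (w (N + 3)) (c (N + 3))) = 0)
    (hy4 : eval y (linForm (w (N + 4)) (c (N + 4))) = 0)
    (hy : eval y (linForm (w' 0) (c' 0)) = 0) :
    linForm (w' 0) (c' 0) * adjPoly (N + 5) w c =
      linForm (w 0) (c 0) * linForm (w (N + 4)) (c (N + 4)) * adjPoly (N + 4) w' c' +
      C (det2 (w 0) (w' 0) * eval x (linForm (w (N + 4)) (c (N + 4)))) *
        ∏ j ∈ Finset.Icc 1 (N + 3), linForm (w j) (c j) := by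
  have e1 := C_det2_cyclic_eq_zero hx0 hx1 hx
  have e2 := C_det2_cyclic_eq_zero hy3 hy4 hy
  have e3 := C_det2_cyclic (w 0) (w' 0) (w (N + 4)) (c 0) (c' 0) (c (N + 4))
  rw [det2_cyclic_eq _ hx0 hx] at e3
  have hL : ∀ t : Finset ℕ, (∀ j ∈ t, 1 ≤ j ∧ j < N + 4) →
      ∏ j ∈ t, linForm (w' j) (c' j) = ∏ j ∈ t, linForm (w j) (c j) := fun t ht =>
    Finset.prod_congr rfl fun j hj => by
      rw [(hw j (ht j hj).1 (ht j hj).2).1, (hw j (ht j hj).1 (ht j hj).2).2]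
  have hsum : ∑ k ∈ Finset.range (N + 2), C (det2 (w' (k + 1)) (w' (k + 2))) *
        ∏ j ∈ ((Finset.Icc 1 (N + 3)).erase (k + 1)).erase (k + 2), linForm (w' j) (c' j) =
      ∑ k ∈ Finset.range (N + 2), C (det2 (w (k + 1)) (w (k + 2))) *
        ∏ j ∈ ((Finset.Icc 1 (N + 3)).erase (k + 1)).erase (k + 2), linForm (w j) (c j) := by
    refine Finset.sum_congr rfl fun k hk => ?_
    have hk' := Finset.mem_range.mp hk
    rw [hL _ (by intro j hj; simp at hj; omega), (hw (k + 1) (by omega) (by omega)).1,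
      (hw (k + 2) (by omega) (by omega)).1]
  have hA : ∏ j ∈ Finset.Icc 1 (N + 3), linForm (w j) (c j) =
      linForm (w 1) (c 1) * (linForm (w (N + 3)) (c (N + 3)) *
        ∏ j ∈ Finset.Icc 2 (N + 2), linForm (w j) (c j)) := by
    rw [show Finset.Icc 1 (N + 3) = insert 1 (insert (N + 3) (Finset.Icc 2 (N + 2))) by
      ext; simp; omega, Finset.prod_insert (by simp), Finset.prod_insert (by simp)]
  rw [hA, adjPoly, adjPoly,
    cyclic_sum_eq N (fun i j => C (det2 (w' i) (w' j))) (fun j => linForm (w' j) (c' j)),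
    cyclic_sum_succ_eq N (fun i j => C (det2 (w i) (w j))) (fun j => linForm (w j) (c j)),
    hsum, hL _ (by intro j hj; simp at hj; omega)]
  simp only [(hw 1 (by omega) (by omega)).1, (hw 1 (by omega) (by omega)).2,
    (hw (N + 3) (by omega) (by omega)).1, (hw (N + 3) (by omega) (by omega)).2]
  generalize (∑ k ∈ Finset.range (N + 2), C (det2 (w (k + 1)) (w (k + 2))) *
    ∏ j ∈ ((Finset.Icc 1 (N + 3)).erase (k + 1)).erase (k + 2), linForm (w j) (c j) :
      MvPolynomial (Fin 2) ℝ) = S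
  generalize ∏ j ∈ Finset.Icc 2 (N + 2), linForm (w j) (c j) = P
  generalize linForm (w 0) (c 0) = l0 at *
  generalize linForm (w 1) (c 1) = l1 at *
  generalize linForm (w' 0) (c' 0) = l at *
  generalize linForm (w (N + 3)) (c (N + 3)) = l3 at *
  generalize hl4 : linForm (w (N + 4)) (c (N + 4)) = l4 at *
  simp only [det2, map_sub, map_mul] at e1 e2 e3 ⊢
  linear_combination l3 * l4 * P * e1 + l0 * l1 * P * e2 + l1 * l3 * P * e3

theorem IsPolygonData.vanish_first {m : ℕ} {v w : ℕ → Fin 2 → ℝ} {c : ℕ → ℝ}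
    (h : IsPolygonData (m + 1) v w c) : eval (v m) (linForm (w 0) (c 0)) = 0 := by
  have := h.vanish_prev 0 (by omega)
  rwa [pred_mod_eq (by omega), if_pos rfl, Nat.add_sub_cancel] at this

theorem IsPolygonData.vanish_succ {m : ℕ} {v w : ℕ → Fin 2 → ℝ} {c : ℕ → ℝ}
    (h : IsPolygonData m v w c) {i : ℕ} (hi : i + 1 < m) :
    eval (v i) (linForm (w (i + 1)) (c (i + 1))) = 0 := by
  have := h.vanish_prev (i + 1) hi
  rwa [pred_mod_eq (by omega), if_neg (by omega), Nat.add_sub_cancel] at this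

theorem IsPolygonData.pos {m : ℕ} {v w : ℕ → Fin 2 → ℝ} {c : ℕ → ℝ}
    (h : IsPolygonData m v w c) {i j : ℕ} (hi : i < m) (hj : j < m) (hij : j ≠ i)
    (hij' : j + 1 ≠ i) (h0 : i = 0 → j + 1 ≠ m) :
    0 < eval (v j) (linForm (w i) (c i)) := by
  refine h.pos_other i hi j hj ?_ hij
  rw [pred_mod_eq (by omega)]
  split_ifs <;> omega

theorem IsPolygonData.det2_first_ne_zero {N : ℕ} {v w w' : ℕ → Fin 2 → ℝ} {c c' : ℕ → ℝ}
    (h : IsPolygonData (N + 5) v w c) (h' : IsPolygonData (N + 4) v w' c') :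
    det2 (w 0) (w' 0) ≠ 0 :=
  det2_ne_zero_of_eval (h.vanish_self 0 (by omega))
    (h.pos (j := N + 3) (by omega) (by omega) (by omega) (by omega) (by omega)).ne'
    (h'.vanish_self 0 (by omega)) h'.vanish_first (h'.normal_ne_zero (by omega))

theorem IsPolygonData.det2_last_ne_zero {N : ℕ} {v w w' : ℕ → Fin 2 → ℝ} {c c' : ℕ → ℝ}
    (h : IsPolygonData (N + 5) v w c) (h' : IsPolygonData (N + 4) v w' c') :
    det2 (w (N + 4)) (w' 0) ≠ 0 :=
  det2_ne_zero_of_eval (h.vanish_succ (i := N + 3) (by omega))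
    (h.pos (j := 0) (by omega) (by omega) (by omega) (by omega) (by omega)).ne'
    h'.vanish_first (h'.vanish_self 0 (by omega)) (h'.normal_ne_zero (by omega))

theorem IsPolygonData.exists_adjPoly_relation {N : ℕ} {v w w' : ℕ → Fin 2 → ℝ} {c c' : ℕ → ℝ}
    (h : IsPolygonData (N + 5) v w c) (h' : IsPolygonData (N + 4) v w' c') :
    ∃ σ K : ℝ, σ ≠ 0 ∧ K ≠ 0 ∧ C σ * (linForm (w' 0) (c' 0) * adjPoly (N + 5) w c) =
      linForm (w 0) (c 0) * linForm (w (N + 4)) (c (N + 4)) * adjPoly (N + 4) w' c' +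
      C K * ∏ j ∈ Finset.Icc 1 (N + 3), linForm (w j) (c j) := by
  have hs : ∀ i, ∃ s : ℝ, s ≠ 0 ∧ (i = 0 → s = 1) ∧
      (1 ≤ i → i < N + 4 → w' i = s • w i ∧ c' i = s * c i) := by
    intro i
    by_cases hi : 1 ≤ i ∧ i < N + 4
    · obtain ⟨s, hs, hs'⟩ := h.exists_scale_s7 h' hi.1 hi.2
      exact ⟨s, hs, by omega, fun _ _ => hs'⟩
    · exact ⟨1, one_ne_zero, fun _ => rfl, by omega⟩
  choose s hs0 hs1 hs using hs
  have hrel := adjPoly_relation_of_eq (N := N) (w := w) (c := c)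
    (w' := fun i => if i = 0 then w' 0 else w i) (c' := fun i => if i = 0 then c' 0 else c i)
    (fun i hi _ => by simp [show i ≠ 0 by omega]) (h.vanish_self 0 (by omega))
    (h.vanish_succ (by omega)) (by simpa using h'.vanish_self 0 (by omega))
    (h.vanish_self (N + 3) (by omega)) (h.vanish_succ (by omega)) (by simpa using h'.vanish_first)
  have hsm := adjPoly_smul (m := N + 4) (by omega) (w' := w') (c' := c') (s := s)
    (w := fun i => if i = 0 then w' 0 else w i) (c := fun i => if i = 0 then c' 0 else c i)
    (fun i hi => by
      by_cases h0 : i = 0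
      · simp [h0, hs1 0 rfl]
      · simpa [h0] using hs i (by omega) hi)
  simp only [if_true] at hrel
  refine ⟨∏ i ∈ Finset.range (N + 4), s i, (∏ i ∈ Finset.range (N + 4), s i) *
    (det2 (w 0) (w' 0) * eval (v 0) (linForm (w (N + 4)) (c (N + 4)))),
    Finset.prod_ne_zero_iff.mpr fun i _ => hs0 i, ?_, ?_⟩
  · exact mul_ne_zero (Finset.prod_ne_zero_iff.mpr fun i _ => hs0 i)
      (mul_ne_zero (h.det2_first_ne_zero h')
        (h.pos (by omega) (by omega) (by omega) (by omega) (by omega)).ne')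
  · rw [hrel, hsm]
    simp only [C_mul]
    ring

theorem aeval_homogenize_relation {N : ℕ} {w w' : ℕ → Fin 2 → ℝ} {c c' : ℕ → ℝ} {σ K : ℝ}
    (h : C σ * (linForm (w' 0) (c' 0) * adjPoly (N + 5) w c) =
      linForm (w 0) (c 0) * linForm (w (N + 4)) (c (N + 4)) * adjPoly (N + 4) w' c' +
      C K * ∏ j ∈ Finset.Icc 1 (N + 3), linForm (w j) (c j)) (z : Fin 3 → ℂ) :
    σ * (projForm (w' 0) (c' 0) z * aeval z (homogenize (N + 2) (adjPoly (N + 5) w c))) =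
      projForm (w 0) (c 0) z * projForm (w (N + 4)) (c (N + 4)) z *
        aeval z (homogenize (N + 1) (adjPoly (N + 4) w' c')) +
      K * ∏ j ∈ Finset.Icc 1 (N + 3), projForm (w j) (c j) z := by
  have affine : ∀ z : Fin 3 → ℂ, z 0 ≠ 0 →
      σ * (projForm (w' 0) (c' 0) z * aeval z (homogenize (N + 2) (adjPoly (N + 5) w c))) =
      projForm (w 0) (c 0) z * projForm (w (N + 4)) (c (N + 4)) z *
        aeval z (homogenize (N + 1) (adjPoly (N + 4) w' c')) +
      K * ∏ j ∈ Finset.Icc 1 (N + 3), projForm (w j) (c j) z := by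
    intro z hz
    have hev := congrArg (aeval ![z 1 / z 0, z 2 / z 0]) h
    simp only [map_mul, map_add, aeval_C, Complex.coe_algebraMap] at hev
    have hd : (adjPoly (N + 5) w c).totalDegree ≤ N + 2 := totalDegree_adjPoly_le (by omega) w c
    have hd' : (adjPoly (N + 4) w' c').totalDegree ≤ N + 1 :=
      totalDegree_adjPoly_le (by omega) w' c'
    rw [aeval_homogenize hd hz, aeval_homogenize hd' hz,
      ← pow_card_mul_aeval_prod_linForm _ _ _ hz, ← mul_aeval_linForm _ _ hz,
      ← mul_aeval_linForm _ _ hz, ← mul_aeval_linForm _ _ hz, Nat.card_Icc,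
      Nat.add_sub_cancel]
    linear_combination z 0 ^ (N + 3) * hev
  by_cases hz : z 0 = 0
  · refine eq_of_eq_punctured_line
      (F := fun z => σ * (projForm (w' 0) (c' 0) z *
        aeval z (homogenize (N + 2) (adjPoly (N + 5) w c))))
      (G := fun z => projForm (w 0) (c 0) z * projForm (w (N + 4)) (c (N + 4)) z *
        aeval z (homogenize (N + 1) (adjPoly (N + 4) w' c')) +
        K * ∏ j ∈ Finset.Icc 1 (N + 3), projForm (w j) (c j) z)
      (u := ![1, 0, 0]) ?_ ?_ fun t ht => affine _ (by simpa [hz] using ht)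
    · exact continuous_const.mul ((continuous_projForm _ _).mul (continuous_aeval_complex _))
    · exact (((continuous_projForm _ _).mul (continuous_projForm _ _)).mul
        (continuous_aeval_complex _)).add
        (continuous_const.mul (continuous_finsetProd _ fun j _ => continuous_projForm _ _))
  · exact affine z hz

theorem eq_smul_of_projForm_eq_zero {a b : Fin 2 → ℝ} {p q : ℝ} {x : Fin 2 → ℝ}
    {z : Fin 3 → ℂ} (hab : det2 a b ≠ 0) (ha : eval x (linForm a p) = 0)
    (hb : eval x (linForm b q) = 0) (hza : projForm a p z = 0) (hzb : projForm b q z = 0) :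
    z = z 0 • (fun s : Fin 3 => if s = 0 then 1 else if s = 1 then (x 0 : ℂ) else (x 1 : ℂ)) := by
  rw [eval_linForm] at ha hb
  rw [projForm] at hza hzb
  have ha' : (p : ℂ) + a 0 * x 0 + a 1 * x 1 = 0 := by exact_mod_cast ha
  have hb' : (q : ℂ) + b 0 * x 0 + b 1 * x 1 = 0 := by exact_mod_cast hb
  have hd : (a 0 * b 1 - a 1 * b 0 : ℂ) ≠ 0 := by
    rw [det2] at hab
    exact_mod_cast hab
  funext s
  fin_cases s
  · simp
  · refine mul_left_cancel₀ hd ?_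
    change _ * z 1 = _ * (z 0 * (x 0 : ℂ))
    linear_combination b 1 * hza - a 1 * hzb - z 0 * (b 1 * ha' - a 1 * hb')
  · refine mul_left_cancel₀ hd ?_
    change _ * z 2 = _ * (z 0 * (x 1 : ℂ))
    linear_combination a 0 * hzb - b 0 * hza - z 0 * (a 0 * hb' - b 0 * ha')

theorem projForm_smul_point (a : Fin 2 → ℝ) (p : ℝ) (x : Fin 2 → ℝ) (t : ℂ) :
    projForm a p (t • (fun s : Fin 3 =>
      if s = 0 then 1 else if s = 1 then (x 0 : ℂ) else (x 1 : ℂ))) =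
      t * (eval x (linForm a p) : ℝ) := by
  rw [eval_linForm, projForm]
  simp
  ring

theorem projForm_smul (s : ℝ) (w : Fin 2 → ℝ) (c : ℝ) (z : Fin 3 → ℂ) :
    projForm (s • w) (s * c) z = s * projForm w c z := by
  simp [projForm]
  ring

/-- Three lines supporting a convex polygon along edges, one of which is the edge that closes the
subpolygon, are not concurrent. -/
theorem IsPolygonData.eval_first_ne_zero {N : ℕ} {v w w' : ℕ → Fin 2 → ℝ} {c c' : ℕ → ℝ}
    (h : IsPolygonData (N + 5) v w c) (h' : IsPolygonData (N + 4) v w' c') {i j : ℕ}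
    (hi : 1 ≤ i) (hij : i + 2 ≤ j) (hj : j ≤ N + 3) (hdet : det2 (w i) (w j) ≠ 0)
    {x : Fin 2 → ℝ} (hxi : eval x (linForm (w i) (c i)) = 0)
    (hxj : eval x (linForm (w j) (c j)) = 0) : eval x (linForm (w' 0) (c' 0)) ≠ 0 := by
  intro hx
  have hcyc := C_det2_cyclic_eq_zero hxi hxj hx
  have key : ∀ y, det2 (w i) (w j) * eval y (linForm (w' 0) (c' 0)) +
      det2 (w j) (w' 0) * eval y (linForm (w i) (c i)) +
      det2 (w' 0) (w i) * eval y (linForm (w j) (c j)) = 0 := fun y => by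
    simpa using congrArg (eval y) hcyc
  have k1 := key (v i)
  have k2 := key (v (j - 1))
  have k3 := key (v 0)
  have hj' := h.vanish_succ (i := j - 1) (by omega)
  rw [Nat.sub_add_cancel (by omega)] at hj'
  rw [h.vanish_self i (by omega)] at k1
  rw [hj'] at k2
  rw [h'.vanish_self 0 (by omega)] at k3
  have p1 := h'.pos (i := 0) (j := i) (by omega) (by omega) (by omega) (by omega) (by omega)
  have p2 := h.pos (i := j) (j := i) (by omega) (by omega) (by omega) (by omega) (by omega)
  have p3 := h'.pos (i := 0) (j := j - 1) (by omega) (by omega) (by omega) (by omega) (by omega)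
  have p4 := h.pos (i := i) (j := j - 1) (by omega) (by omega) (by omega) (by omega) (by omega)
  have p5 := h.pos (i := j) (j := 0) (by omega) (by omega) (by omega) (by omega) (by omega)
  have p6 : 0 ≤ eval (v 0) (linForm (w i) (c i)) := by
    rcases Nat.eq_or_lt_of_le hi with rfl | hi
    · exact (h.vanish_succ (by omega)).ge
    · exact (h.pos (by omega) (by omega) (by omega) (by omega) (by omega)).le
  rcases lt_or_gt_of_ne hdet with hD | hD
  · have A : 0 < det2 (w' 0) (w i) := pos_of_mul_pos_left (by nlinarith) p2.le
    have B : 0 < det2 (w j) (w' 0) := pos_of_mul_pos_left (by nlinarith) p4.le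
    nlinarith [mul_nonneg B.le p6, mul_pos A p5]
  · have A : 0 < -det2 (w' 0) (w i) := pos_of_mul_pos_left (by nlinarith) p2.le
    have B : 0 < -det2 (w j) (w' 0) := pos_of_mul_pos_left (by nlinarith) p4.le
    nlinarith [mul_nonneg B.le p6, mul_pos A p5]

theorem IsPolygonData.adjPoly_common_zero_iff {N : ℕ} {v w w' : ℕ → Fin 2 → ℝ} {c c' : ℕ → ℝ}
    (h : IsPolygonData (N + 5) v w c) (h' : IsPolygonData (N + 4) v w' c')
    (hnonpar : ∀ i < N + 5, ∀ j < N + 5, i ≠ j → det2 (w i) (w j) ≠ 0)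
    {q : ℕ → ℕ → Fin 2 → ℝ}
    (hq : ∀ i j : ℕ, 1 ≤ i → i + 2 ≤ j → j ≤ N + 3 →
      eval (q i j) (linForm (w i) (c i)) = 0 ∧ eval (q i j) (linForm (w j) (c j)) = 0)
    {z : Fin 3 → ℂ} (hz : z ≠ 0) :
    (aeval z (homogenize (N + 2) (adjPoly (N + 5) w c)) = 0 ∧
        aeval z (homogenize (N + 1) (adjPoly (N + 4) w' c')) = 0) ↔
      ∃ i j : ℕ, 1 ≤ i ∧ i + 2 ≤ j ∧ j ≤ N + 3 ∧
        ∃ t : ℂ, t ≠ 0 ∧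
          z = t • (fun s : Fin 3 => if s = 0 then 1 else if s = 1 then (q i j 0 : ℂ)
            else (q i j 1 : ℂ)) := by
  constructor
  · rintro ⟨hz1, hz2⟩
    have found : ∀ i j, 1 ≤ i → i + 2 ≤ j → j ≤ N + 3 → projForm (w i) (c i) z = 0 →
        projForm (w j) (c j) z = 0 → ∃ i j : ℕ, 1 ≤ i ∧ i + 2 ≤ j ∧ j ≤ N + 3 ∧
        ∃ t : ℂ, t ≠ 0 ∧ z = t • (fun s : Fin 3 => if s = 0 then 1 else
          if s = 1 then (q i j 0 : ℂ) else (q i j 1 : ℂ)) := by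
      intro i j hi hij hj hzi hzj
      have e := eq_smul_of_projForm_eq_zero (hnonpar i (by omega) j (by omega) (by omega))
        (hq i j hi hij hj).1 (hq i j hi hij hj).2 hzi hzj
      refine ⟨i, j, hi, hij, hj, z 0, fun h0 => hz ?_, e⟩
      rw [e, h0, zero_smul]
    have absurd_vertex : ∀ a, ∀ i < N + 5, ∀ x : Fin 2 → ℝ, ∀ p, det2 a (w' 0) ≠ 0 →
        eval x (linForm a p) = 0 → eval x (linForm (w' 0) (c' 0)) = 0 →
        0 < eval x (linForm (w i) (c i)) → projForm a p z = 0 →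
        projForm (w' 0) (c' 0) z = 0 → projForm (w i) (c i) z = 0 → False := by
      intro a i _ x p hd hax hx hpos hza hzm hzi
      have e := eq_smul_of_projForm_eq_zero hd hax hx hza hzm
      rw [e, projForm_smul_point] at hzi
      rcases mul_eq_zero.mp hzi with h0 | h0
      · exact hz (by rw [e, h0, zero_smul])
      · exact hpos.ne' (by exact_mod_cast h0)
    obtain ⟨σ, K, -, hK, hrel⟩ := h.exists_adjPoly_relation h'
    have hrel := aeval_homogenize_relation hrel z
    rw [hz1, hz2, mul_zero, mul_zero, mul_zero, zero_add, eq_comm, mul_eq_zero,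
      Finset.prod_eq_zero_iff] at hrel
    obtain ⟨i, hi, hzi⟩ := hrel.resolve_left (by exact_mod_cast hK)
    obtain ⟨hi1, hi2⟩ := Finset.mem_Icc.mp hi
    have found' : ∀ j, 1 ≤ j → j ≤ N + 3 → j ≠ i → j + 1 ≠ i → j ≠ i + 1 →
        projForm (w j) (c j) z = 0 → _ := fun j hj1 hj2 hj3 hj4 hj5 hzj =>
      if hlt : i < j then found i j hi1 (by omega) hj2 hzi hzj
      else found j i hj1 (by omega) hi2 hzj hzi
    obtain ⟨K₁, hK₁, hl⟩ := h.exists_homogenize_eq (i := i) (by omega)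
    have hl := (hl z hzi).symm.trans hz1
    rw [mul_eq_zero, Finset.prod_eq_zero_iff] at hl
    obtain ⟨j, hj, hzj⟩ := hl.resolve_left (by exact_mod_cast hK₁)
    rw [mem_farIndices, succ_mod_eq (by omega), pred_mod_eq (by omega), if_neg (by omega),
      if_neg (by omega)] at hj
    by_cases hj' : 1 ≤ j ∧ j ≤ N + 3
    · exact found' j hj'.1 hj'.2 (by omega) (by omega) (by omega) hzj
    obtain ⟨s, -, hws, hcs⟩ := h.exists_scale_s7 h' hi1 (by omega)
    obtain ⟨K₂, hK₂, hl'⟩ := h'.exists_homogenize_eq (i := i) (by omega)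
    have hl' := (hl' z (by rw [hws, hcs, projForm_smul, hzi, mul_zero])).symm.trans hz2
    rw [mul_eq_zero, Finset.prod_eq_zero_iff] at hl'
    obtain ⟨k, hk, hzk⟩ := hl'.resolve_left (by exact_mod_cast hK₂)
    rw [mem_farIndices, succ_mod_eq (by omega), pred_mod_eq (by omega),
      if_neg (show i ≠ 0 by omega)] at hk
    by_cases hk' : 1 ≤ k
    · obtain ⟨r, hr, hwr, hcr⟩ := h.exists_scale_s7 h' hk' hk.1
      rw [hwr, hcr, projForm_smul, mul_eq_zero] at hzk
      have hik : k ≠ i + 1 := by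
        have := hk.2.2.1
        split_ifs at this <;> omega
      exact found' k hk' (by omega) hk.2.1 (by omega) hik
        (hzk.resolve_left (by exact_mod_cast hr))
    · obtain rfl : k = 0 := by omega
      have hi3 : i ≠ N + 3 := by
        have := hk.2.2.1
        split_ifs at this <;> omega
      exfalso
      rcases (show j = 0 ∨ j = N + 4 by omega) with rfl | rfl
      · exact absurd_vertex _ i (by omega) (v 0) _ (h.det2_first_ne_zero h')
          (h.vanish_self 0 (by omega)) (h'.vanish_self 0 (by omega))
          (h.pos (by omega) (by omega) (by omega) (by omega) (by omega)) hzj hzk hzi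
      · exact absurd_vertex _ i (by omega) (v (N + 3)) _ (h.det2_last_ne_zero h')
          (h.vanish_succ (by omega)) h'.vanish_first
          (h.pos (by omega) (by omega) (by omega) (by omega) (by omega)) hzj hzk hzi
  · rintro ⟨i, j, hi, hij, hj, t, -, hzt⟩
    have hzi : projForm (w i) (c i) z = 0 := by
      rw [hzt, projForm_smul_point, (hq i j hi hij hj).1, Complex.ofReal_zero, mul_zero]
    have hzj : projForm (w j) (c j) z = 0 := by
      rw [hzt, projForm_smul_point, (hq i j hi hij hj).2, Complex.ofReal_zero, mul_zero]
    obtain ⟨s, -, hws, hcs⟩ := h.exists_scale_s7 h' hi (by omega)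
    obtain ⟨r, -, hwr, hcr⟩ := h.exists_scale_s7 h' (i := j) (by omega) (by omega)
    obtain ⟨K₁, -, hl⟩ := h.exists_homogenize_eq (i := i) (by omega)
    obtain ⟨K₂, -, hl'⟩ := h'.exists_homogenize_eq (i := i) (by omega)
    constructor
    · refine (hl z hzi).trans (mul_eq_zero_of_right _ (Finset.prod_eq_zero (i := j) ?_ hzj))
      rw [mem_farIndices, succ_mod_eq (by omega), pred_mod_eq (by omega)]
      split_ifs <;> omega
    · refine (hl' z (by rw [hws, hcs, projForm_smul, hzi, mul_zero])).trans
        (mul_eq_zero_of_right _ (Finset.prod_eq_zero (i := j) ?_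
          (by rw [hwr, hcr, projForm_smul, hzj, mul_zero])))
      rw [mem_farIndices, succ_mod_eq (by omega), pred_mod_eq (by omega)]
      split_ifs <;> omega

/-- The adjoint vanishes at the intersection of two non-adjacent facet lines. -/
theorem IsPolygonData.eval_adjPoly_eq_zero {m : ℕ} {v w : ℕ → Fin 2 → ℝ} {c : ℕ → ℝ}
    (h : IsPolygonData m v w c) {i j : ℕ} (hi : i < m) (hj : j ∈ farIndices m i)
    {x : Fin 2 → ℝ} (hxi : eval x (linForm (w i) (c i)) = 0)
    (hxj : eval x (linForm (w j) (c j)) = 0) : eval x (adjPoly m w c) = 0 := by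
  obtain ⟨K, -, R, hR⟩ := h.exists_adjPoly_eq hi
  rw [hR, map_add, map_mul, map_mul, hxi, map_prod,
    Finset.prod_eq_zero (f := fun j => eval x (linForm (w j) (c j))) hj hxj]
  simp

/-- The adjoint is smooth at the intersection of two non-adjacent facet lines that lies on no
other facet line. -/
theorem IsPolygonData.pderiv_adjPoly_ne_zero {m : ℕ} {v w : ℕ → Fin 2 → ℝ} {c : ℕ → ℝ}
    (h : IsPolygonData m v w c) {i j : ℕ} (hi : i < m) (hj : j ∈ farIndices m i)
    (hdet : det2 (w i) (w j) ≠ 0) {x : Fin 2 → ℝ} (hxi : eval x (linForm (w i) (c i)) = 0)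
    (hxj : eval x (linForm (w j) (c j)) = 0)
    (hx : ∀ k < m, k ≠ i → k ≠ j → eval x (linForm (w k) (c k)) ≠ 0) :
    eval x (pderiv 0 (adjPoly m w c)) ≠ 0 ∨ eval x (pderiv 1 (adjPoly m w c)) ≠ 0 := by
  obtain ⟨K, hK, R, hR⟩ := h.exists_adjPoly_eq hi
  have hder : ∀ d, eval x (pderiv d (adjPoly m w c)) =
      K * (∏ k ∈ (farIndices m i).erase j, eval x (linForm (w k) (c k))) * w j d +
        w i d * eval x R := by
    intro d
    rw [hR, ← Finset.mul_prod_erase _ _ hj]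
    simp only [map_add, Derivation.leibniz, pderiv_linForm, pderiv_C, smul_eq_mul, map_mul,
      eval_C, hxi, hxj, map_prod, map_zero]
    ring
  have hM : K * ∏ k ∈ (farIndices m i).erase j, eval x (linForm (w k) (c k)) ≠ 0 := by
    refine mul_ne_zero hK (Finset.prod_ne_zero_iff.mpr fun k hk => ?_)
    rw [Finset.mem_erase, mem_farIndices] at hk
    exact hx k hk.2.1 hk.2.2.1 hk.1
  by_contra! hcon
  rw [hder, hder] at hcon
  refine mul_ne_zero hM hdet ?_
  rw [det2]
  linear_combination w i 0 * hcon.2 - w i 1 * hcon.1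

theorem IsPolygonData.pderiv_adjPoly_parallel {N : ℕ} {v w w' : ℕ → Fin 2 → ℝ} {c c' : ℕ → ℝ}
    (h : IsPolygonData (N + 5) v w c) (h' : IsPolygonData (N + 4) v w' c') {i j : ℕ}
    (hi : 1 ≤ i) (hij : i + 2 ≤ j) (hj : j ≤ N + 3) (hdet : det2 (w i) (w j) ≠ 0)
    {x : Fin 2 → ℝ} (hxi : eval x (linForm (w i) (c i)) = 0)
    (hxj : eval x (linForm (w j) (c j)) = 0)
    (hx : ∀ k < N + 5, k ≠ i → k ≠ j → eval x (linForm (w k) (c k)) ≠ 0) :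
    ∃ μ : ℝ, μ ≠ 0 ∧ ∀ d : Fin 2, eval x (pderiv d (adjPoly (N + 4) w' c')) =
      μ * eval x (pderiv d (adjPoly (N + 5) w c)) := by
  have hfar : j ∈ farIndices (N + 5) i := by
    rw [mem_farIndices, succ_mod_eq (by omega), pred_mod_eq (by omega)]
    split_ifs <;> omega
  have hfar' : j ∈ farIndices (N + 4) i := by
    rw [mem_farIndices, succ_mod_eq (by omega), pred_mod_eq (by omega)]
    split_ifs <;> omega
  obtain ⟨s, -, hws, hcs⟩ := h.exists_scale_s7 h' hi (by omega)
  obtain ⟨r, -, hwr, hcr⟩ := h.exists_scale_s7 h' (i := j) (by omega) (by omega)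
  have hA := h.eval_adjPoly_eq_zero (by omega) hfar hxi hxj
  have hA' := h'.eval_adjPoly_eq_zero (by omega) hfar'
    (by rw [hws, hcs, linForm_smul, map_mul, hxi, mul_zero])
    (by rw [hwr, hcr, linForm_smul, map_mul, hxj, mul_zero])
  obtain ⟨σ, K, hσ, -, hrel⟩ := h.exists_adjPoly_relation h'
  have hm := h.eval_first_ne_zero h' hi hij hj hdet hxi hxj
  have h0 := hx 0 (by omega) (by omega) (by omega)
  have h4 := hx (N + 4) (by omega) (by omega) (by omega)
  refine ⟨σ * eval x (linForm (w' 0) (c' 0)) /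
    (eval x (linForm (w 0) (c 0)) * eval x (linForm (w (N + 4)) (c (N + 4)))),
    div_ne_zero (mul_ne_zero hσ hm) (mul_ne_zero h0 h4), fun d => ?_⟩
  rw [← Finset.mul_prod_erase (Finset.Icc 1 (N + 3)) _ (Finset.mem_Icc.mpr ⟨hi, by omega⟩),
    ← Finset.mul_prod_erase ((Finset.Icc 1 (N + 3)).erase i) _ (Finset.mem_erase.mpr
      ⟨show j ≠ i by omega, Finset.mem_Icc.mpr ⟨by omega, hj⟩⟩)] at hrel
  have hder := congrArg (fun p => eval x (pderiv d p)) hrel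
  simp only [map_add, Derivation.leibniz, pderiv_linForm, pderiv_C, smul_eq_mul, map_mul,
    eval_C, hxi, hxj, hA, hA', mul_zero, zero_mul, add_zero, zero_add] at hder
  field_simp
  linear_combination -hder

/- Vertices are indexed `0, …, n-1`, so the paper's vertex `v_i` is `v (i-1)` here; the
pairs of facet lines `2 ≤ i, i+2 ≤ j ≤ n-1` of the paper become `1 ≤ i, i+2 ≤ j ≤ n-2`.
`P' = conv(v 0, …, v (n-2))` is the polygon obtained by removing the last vertex. -/
theorem stmt_7 (n : ℕ) (hn : 5 ≤ n) (v w : ℕ → Fin 2 → ℝ) (c : ℕ → ℝ)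
    (hP : IsPolygonData n v w c)
    (hnonpar : ∀ i < n, ∀ j < n, i ≠ j → det2 (w i) (w j) ≠ 0)
    (hnothree : ∀ i < n, ∀ j < n, ∀ k < n, i ≠ j → i ≠ k → j ≠ k →
      ¬ ∃ x : Fin 2 → ℝ, eval x (linForm (w i) (c i)) = 0 ∧
        eval x (linForm (w j) (c j)) = 0 ∧ eval x (linForm (w k) (c k)) = 0)
    (q : ℕ → ℕ → Fin 2 → ℝ)
    (hq : ∀ i j : ℕ, 1 ≤ i → i + 2 ≤ j → j ≤ n - 2 →
      eval (q i j) (linForm (w i) (c i)) = 0 ∧ eval (q i j) (linForm (w j) (c j)) = 0)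
    (α' : MvPolynomial (Fin 2) ℝ) (hα' : IsAdjointOf (n - 1) v α') :
    (∀ z : Fin 3 → ℂ, z ≠ 0 →
      ((aeval z (homogenize (n - 3) (adjPoly n w c)) = 0 ∧
          aeval z (homogenize (n - 4) α') = 0) ↔
        ∃ i j : ℕ, 1 ≤ i ∧ i + 2 ≤ j ∧ j ≤ n - 2 ∧
          ∃ t : ℂ, t ≠ 0 ∧
            z = t • (fun s : Fin 3 => if s = 0 then 1 else if s = 1 then (q i j 0 : ℂ)
              else (q i j 1 : ℂ)))) ∧
    (∀ i j : ℕ, 1 ≤ i → i + 2 ≤ j → j ≤ n - 2 →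
      (eval (q i j) (pderiv 0 (adjPoly n w c)) ≠ 0 ∨
        eval (q i j) (pderiv 1 (adjPoly n w c)) ≠ 0) ∧
      ∃ μ : ℝ, μ ≠ 0 ∧ ∀ d : Fin 2,
        eval (q i j) (pderiv d α') = μ * eval (q i j) (pderiv d (adjPoly n w c))) := by
  obtain ⟨N, rfl⟩ : ∃ N, n = N + 5 := ⟨n - 5, by omega⟩
  obtain ⟨w', c', h', rfl⟩ := hα'
  refine ⟨fun z hz => hP.adjPoly_common_zero_iff h' hnonpar hq hz, fun i j hi hij hj => ?_⟩
  replace hj : j ≤ N + 3 := hj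
  obtain ⟨hqi, hqj⟩ := hq i j hi hij hj
  have hdet := hnonpar i (by omega) j (by omega) (by omega)
  have hx : ∀ k < N + 5, k ≠ i → k ≠ j → eval (q i j) (linForm (w k) (c k)) ≠ 0 :=
    fun k hk hki hkj h0 => hnothree i (by omega) j (by omega) k hk (by omega) hki.symm hkj.symm
      ⟨q i j, hqi, hqj, h0⟩
  refine ⟨hP.pderiv_adjPoly_ne_zero (i := i) (j := j) (by omega) ?_ hdet hqi hqj hx,
    hP.pderiv_adjPoly_parallel h' hi hij hj hdet hqi hqj hx⟩
  rw [mem_farIndices, succ_mod_eq (by omega), pred_mod_eq (by omega)]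
  split_ifs <;> omega
end
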